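/- arXiv:1408.5194 — 2 statements merged into one kernel-verified Lean document; each statement's English description precedes it below -/
import Mathlib

section
/- Let ℓ be a prime and let K ⊆ L be a finite purely inseparable extension of fields of characteristic different from ℓ. Then for every n ≥ 1 the natural map k^M_n(K) → k^M_n(L) induced by the inclusion K ⊆ L is an isomorphism. -/
/-! Common definitions: mod-ℓ Milnor K-theory, K^×/(K^×)^ℓ, Ω_K, relative algebraic
closure, transcendence degree predicates, discrete valuations, etc. -/

noncomputable section

open scoped TensorProduct

universe u v

/-- The `n`-fold tensor power (over `ℤ`) of the multiplicative group `Kˣ`,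
written additively. -/
abbrev MilnorPre (n : ℕ) (K : Type*) [Field K] : Type _ :=
  PiTensorProduct ℤ (fun _ : Fin n => Additive Kˣ)

/-- The submodule of Steinberg relations: generated by all `a₁ ⊗ ⋯ ⊗ aₙ`
with `aᵢ + aⱼ = 1` for some `i < j`. -/
def SteinbergRel (n : ℕ) (K : Type*) [Field K] : Submodule ℤ (MilnorPre n K) :=
  Submodule.span ℤ
    {x | ∃ a : Fin n → Kˣ,
      (∃ i j : Fin n, i < j ∧ ((a i : K) + (a j : K) = 1)) ∧
        x = PiTensorProduct.tprod ℤ (fun i => Additive.ofMul (a i))}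

/-- The `n`-th Milnor K-group `K^M_n(K)`: the quotient of the `n`-fold tensor
power of `K^×` by the Steinberg relations. -/
abbrev MilnorK (n : ℕ) (K : Type*) [Field K] : Type _ :=
  MilnorPre n K ⧸ SteinbergRel n K

/-- The mod-`ℓ` Milnor K-group `k^M_n(K) = K^M_n(K)/ℓ`. -/
abbrev MilnorKMod (ℓ n : ℕ) (K : Type*) [Field K] : Type _ :=
  MilnorK n K ⧸ LinearMap.range ((ℓ : ℤ) • (LinearMap.id : MilnorK n K →ₗ[ℤ] MilnorK n K))

/-- The symbol `{a₁, …, aₙ}` in `k^M_n(K)`. -/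
def milnorSymbol (ℓ : ℕ) {n : ℕ} {K : Type*} [Field K] (a : Fin n → Kˣ) :
    MilnorKMod ℓ n K :=
  Submodule.Quotient.mk (Submodule.Quotient.mk
    (PiTensorProduct.tprod ℤ (fun i => Additive.ofMul (a i))))

/-- `k^M_1(K) = K^×/(K^×)^ℓ`, written multiplicatively. -/
abbrev K1 (ℓ : ℕ) (K : Type*) [Field K] : Type _ :=
  Kˣ ⧸ (powMonoidHom ℓ : Kˣ →* Kˣ).range

/-- The projection `K^× → K^×/(K^×)^ℓ`. -/
def K1proj (ℓ : ℕ) (K : Type*) [Field K] : Kˣ →* K1 ℓ K :=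
  QuotientGroup.mk' _

/-- The subgroup of `Kˣ` consisting of the units lying in an intermediate field `L`. -/
def fieldUnits {k K : Type*} [Field k] [Field K] [Algebra k K]
    (L : IntermediateField k K) : Subgroup Kˣ where
  carrier := {x : Kˣ | (x : K) ∈ L}
  one_mem' := by simpa using one_mem L
  mul_mem' := by
    intro a b ha hb
    simpa using mul_mem ha hb
  inv_mem' := by
    intro a ha
    simpa using inv_mem (show (a : K) ∈ L from ha)

/-- `Ω_K(L)`: the image of `L^×` in `K^×/(K^×)^ℓ`. -/
def Omega (ℓ : ℕ) {k K : Type*} [Field k] [Field K] [Algebra k K]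
    (L : IntermediateField k K) : Subgroup (K1 ℓ K) :=
  (fieldUnits L).map (K1proj ℓ K)

/-- A subextension `L` of `K|k` is relatively algebraically closed in `K` if every
element of `K` algebraic over `L` lies in `L`. -/
def RelAlgClosed {k K : Type*} [Field k] [Field K] [Algebra k K]
    (L : IntermediateField k K) : Prop :=
  ∀ x : K, IsAlgebraic L x → x ∈ L

/-- `K` is a function field over `k`: a finitely generated field extension. -/
def IsFunctionField (k K : Type*) [Field k] [Field K] [Algebra k K] : Prop :=
  ∃ s : Finset K, IntermediateField.adjoin k (s : Set K) = ⊤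

/-- `trdeg(K|k) = d`: there is a transcendence basis indexed by `Fin d`. -/
def HasTrdeg (k : Type*) (K : Type*) [Field k] [Field K] [Algebra k K] (d : ℕ) : Prop :=
  ∃ x : Fin d → K, IsTranscendenceBasis k x

/-- `trdeg(K|k) ≥ m`: there are `m` algebraically independent elements. -/
def TrdegGe (k : Type*) (K : Type*) [Field k] [Field K] [Algebra k K] (m : ℕ) : Prop :=
  ∃ x : Fin m → K, AlgebraicIndependent k x

/-- `dim^M_K(S) ≥ d` for a subset `S ⊆ k^M_1(K)`: there are `s₁, …, s_d ∈ S` with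
`{s₁, …, s_d} ≠ 0` in `k^M_d(K)`. -/
def dimMge (ℓ : ℕ) {K : Type*} [Field K] (S : Set (K1 ℓ K)) (d : ℕ) : Prop :=
  ∃ a : Fin d → Kˣ, (∀ i, K1proj ℓ K (a i) ∈ S) ∧ milnorSymbol ℓ a ≠ 0

/-- `dim^M_K(S) = r`. -/
def dimMeq (ℓ : ℕ) {K : Type*} [Field K] (S : Set (K1 ℓ K)) (r : ℕ) : Prop :=
  dimMge ℓ S r ∧ ¬ dimMge ℓ S (r + 1)

/-- `t` is a general element of `K` over `k`: `t ∉ k` and `k(t)` is relatively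
algebraically closed in `K`. -/
def IsGeneralElement (k : Type*) {K : Type*} [Field k] [Field K] [Algebra k K] (t : K) : Prop :=
  t ∉ (⊥ : IntermediateField k K) ∧ RelAlgClosed (IntermediateField.adjoin k {t})

/-- A rational subgroup of `k^M_1(K)`: `Ω_K(k(t))` for a general element `t`. -/
def IsRationalSubgroup (ℓ : ℕ) (k : Type*) {K : Type*} [Field k] [Field K] [Algebra k K]
    (A : Subgroup (K1 ℓ K)) : Prop :=
  ∃ t : K, IsGeneralElement k t ∧ A = Omega ℓ (IntermediateField.adjoin k {t})

/-- `𝔊^r(K|k)`: the subgroups `Ω_K(L)` for `L` relatively algebraically closed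
in `K` of transcendence degree `r` over `k`. -/
def GSet (ℓ : ℕ) (k : Type*) {K : Type*} [Field k] [Field K] [Algebra k K] (r : ℕ) :
    Set (Subgroup (K1 ℓ K)) :=
  {A | ∃ L : IntermediateField k K, RelAlgClosed L ∧ HasTrdeg k L r ∧ A = Omega ℓ L}

/-- `𝔐^1(K)`: subgroups maximal among the subgroups `B` of `k^M_1(K)`
with `dim^M_K(B) = 1`. -/
def M1Set (ℓ : ℕ) (K : Type*) [Field K] : Set (Subgroup (K1 ℓ K)) :=
  {A | dimMeq ℓ (A : Set (K1 ℓ K)) 1 ∧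
    ∀ B : Subgroup (K1 ℓ K), dimMeq ℓ (B : Set (K1 ℓ K)) 1 → A ≤ B → B = A}

/-- Condition (a) and (b) of the maximality characterization of `𝔊^r`:
`B` is generated by rational subgroups and `dim^M_K(B) = r`. -/
def SpannedByRatWithDim (ℓ : ℕ) (k : Type*) {K : Type*} [Field k] [Field K] [Algebra k K]
    (r : ℕ) (B : Subgroup (K1 ℓ K)) : Prop :=
  (∃ S : Set (Subgroup (K1 ℓ K)), (∀ T ∈ S, IsRationalSubgroup ℓ k T) ∧ B = sSup S) ∧
    dimMeq ℓ (B : Set (K1 ℓ K)) r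

/-- A discrete valuation of a field `F`: a surjective homomorphism `F^× → ℤ`
satisfying the ultrametric inequality. -/
structure DiscreteValuation (F : Type*) [Field F] where
  v : Fˣ → ℤ
  map_mul' : ∀ x y : Fˣ, v (x * y) = v x + v y
  surjective' : Function.Surjective v
  min_le' : ∀ x y z : Fˣ, (x : F) + (y : F) = (z : F) → min (v x) (v y) ≤ v z

lemma DiscreteValuation.v_one {F : Type*} [Field F] (w : DiscreteValuation F) : w.v 1 = 0 := by
  have h := w.map_mul' 1 1
  simp only [mul_one] at h
  omega

/-- A discrete valuation of `F` is trivial on the base field `k`. -/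
def DiscreteValuation.TrivialOn (k : Type*) {F : Type*} [Field k] [Field F] [Algebra k F]
    (w : DiscreteValuation F) : Prop :=
  ∀ (c : k) (hc : algebraMap k F c ≠ 0), w.v (Units.mk0 _ hc) = 0

/-- The unit group `U_w ⊆ F^×` of a discrete valuation. -/
def DiscreteValuation.units {F : Type*} [Field F] (w : DiscreteValuation F) : Subgroup Fˣ where
  carrier := {x : Fˣ | w.v x = 0}
  one_mem' := w.v_one
  mul_mem' := by
    intro a b ha hb
    have h := w.map_mul' a b
    simp only [Set.mem_setOf_eq] at ha hb ⊢
    omega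
  inv_mem' := by
    intro a ha
    have h := w.map_mul' a a⁻¹
    rw [mul_inv_cancel] at h
    have h1 := w.v_one
    simp only [Set.mem_setOf_eq] at ha ⊢
    omega

/-- `𝔘_v`: the image of the unit group `U_v` in `K^×/(K^×)^ℓ`. -/
def DiscreteValuation.unitsImage (ℓ : ℕ) {F : Type*} [Field F] (w : DiscreteValuation F) :
    Subgroup (K1 ℓ F) :=
  w.units.map (K1proj ℓ F)

/-- For a discrete valuation `w` of an intermediate field `F` of `K|k`, the image of
the unit group `U_w` in `K^×/(K^×)^ℓ`. -/
def unitsImageIn (ℓ : ℕ) {k K : Type*} [Field k] [Field K] [Algebra k K]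
    (F : IntermediateField k K) (w : DiscreteValuation F) : Subgroup (K1 ℓ K) :=
  (w.units.map (Units.map (algebraMap F K).toMonoidHom)).map (K1proj ℓ K)

/-- The residue field of `v` has transcendence degree `≥ m` over `k`: there are
`v`-units `x₁, …, x_m` whose residues are algebraically independent over `k`,
expressed by saying that every nonzero polynomial over `k` evaluated at the `xᵢ`
is a unit of value `0`. -/
def DiscreteValuation.ResidueTrdegGe (k : Type*) {K : Type*} [Field k] [Field K] [Algebra k K]
    (v : DiscreteValuation K) (m : ℕ) : Prop :=
  ∃ x : Fin m → Kˣ, (∀ i, v.v (x i) = 0) ∧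
    ∀ P : MvPolynomial (Fin m) k, P ≠ 0 →
      ∃ u : Kˣ, (u : K) = MvPolynomial.aeval (fun i => ((x i : K))) P ∧ v.v u = 0

/-- A divisorial-type valuation of `K|k` (where `d = trdeg(K|k)`): a discrete valuation
trivial on `k` whose residue field has transcendence degree exactly `d - 1` over `k`. -/
def IsDivisorialType (k : Type*) {K : Type*} [Field k] [Field K] [Algebra k K] (d : ℕ)
    (v : DiscreteValuation K) : Prop :=
  v.TrivialOn k ∧ v.ResidueTrdegGe k (d - 1) ∧ ¬ v.ResidueTrdegGe k d

/-- `Δ_A`: the set of subgroups `A ⊓ 𝔘_v`, for `v` ranging over the divisorial-type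
valuations of `K` with `A ⊄ 𝔘_v`. -/
def DeltaA (ℓ : ℕ) (k : Type*) {K : Type*} [Field k] [Field K] [Algebra k K] (d : ℕ)
    (A : Subgroup (K1 ℓ K)) : Set (Subgroup (K1 ℓ K)) :=
  {T | ∃ v : DiscreteValuation K, IsDivisorialType k d v ∧
    ¬ A ≤ v.unitsImage ℓ ∧ T = A ⊓ v.unitsImage ℓ}

/-- A good rational subgroup: a rational subgroup `A = Ω_K(k(t))` such that for every
discrete valuation `w` of `k(t)` trivial on `k`, the image of `U_w` in `K^×/(K^×)^ℓ`
belongs to `Δ_A`. -/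
def IsGoodRationalSubgroup (ℓ : ℕ) (k : Type*) {K : Type*} [Field k] [Field K] [Algebra k K]
    (d : ℕ) (A : Subgroup (K1 ℓ K)) : Prop :=
  ∃ t : K, IsGeneralElement k t ∧ A = Omega ℓ (IntermediateField.adjoin k {t}) ∧
    ∀ w : DiscreteValuation (IntermediateField.adjoin k {t}), w.TrivialOn k →
      unitsImageIn ℓ (IntermediateField.adjoin k {t}) w ∈ DeltaA ℓ k d A

/-- A very general element: a general element `t` such that `Ω_K(k(t))` is a good
rational subgroup. -/
def IsVeryGeneral (ℓ : ℕ) (k : Type*) {K : Type*} [Field k] [Field K] [Algebra k K]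
    (d : ℕ) (t : K) : Prop :=
  IsGeneralElement k t ∧ IsGoodRationalSubgroup ℓ k d (Omega ℓ (IntermediateField.adjoin k {t}))

/-- `x` is separable in `K`: in characteristic `p > 0`, `x` is not a `p`-th power;
in characteristic `0` every element is separable. -/
def IsSeparableIn (K : Type*) [Field K] (x : K) : Prop :=
  ∀ p : ℕ, p.Prime → CharP K p → ¬ ∃ y : K, y ^ p = x

/-- A perfect closure of `K`: a perfect field which is a purely inseparable
extension of `K`. -/
structure PerfectClosureOf (K : Type u) [Field K] : Type (u + 1) where
  carrier : Type u
  [fieldInst : Field carrier]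
  [algebraInst : Algebra K carrier]
  purelyInseparable : IsPurelyInseparable K carrier
  perfect : PerfectField carrier

attribute [instance] PerfectClosureOf.fieldInst PerfectClosureOf.algebraInst

/-- A group isomorphism `φ : k^M_1(K) → k^M_1(L)` is induced by a field isomorphism
`σ : K^i → L^i` of the perfect closures, via the canonical identifications
`k^M_1(K) ≅ k^M_1(K^i)` and `k^M_1(L) ≅ k^M_1(L^i)`. -/
def InducesOnK1 (ℓ : ℕ) {K : Type u} {L : Type v} [Field K] [Field L]
    (PK : PerfectClosureOf K) (PL : PerfectClosureOf L)
    (σ : PK.carrier ≃+* PL.carrier) (φ : K1 ℓ K ≃* K1 ℓ L) : Prop :=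
  ∀ (x : Kˣ) (y : Lˣ),
    (φ (K1proj ℓ K x) = K1proj ℓ L y ↔
      ∃ z : (PL.carrier)ˣ,
        Units.map σ.toRingHom.toMonoidHom
            (Units.map (algebraMap K PK.carrier).toMonoidHom x) =
          Units.map (algebraMap L PL.carrier).toMonoidHom y * z ^ ℓ)

/-- `φ : k^M_1(K) → k^M_1(L)` is compatible with `k^M_2`: `φ ⊗ φ` descends, along the
multiplication maps, to an isomorphism `k^M_2(K) → k^M_2(L)`; equivalently, there is an
additive isomorphism `k^M_2(K) ≃ k^M_2(L)` carrying `{a, b}` to `{a', b'}` whenever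
`φ` carries the class of `a` (resp. `b`) to the class of `a'` (resp. `b'`). -/
def CompatWithK2 (ℓ : ℕ) {K L : Type*} [Field K] [Field L] (φ : K1 ℓ K ≃* K1 ℓ L) : Prop :=
  ∃ ψ : MilnorKMod ℓ 2 K ≃+ MilnorKMod ℓ 2 L,
    ∀ (a b : Kˣ) (a' b' : Lˣ),
      φ (K1proj ℓ K a) = K1proj ℓ L a' → φ (K1proj ℓ K b) = K1proj ℓ L b' →
        ψ (milnorSymbol ℓ ![a, b]) = milnorSymbol ℓ ![a', b']

/-- `φ : k^M_1(K) → k^M_1(L)` is compatible with `𝔊^1_rat`: it maps rational subgroups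
bijectively onto rational subgroups. -/
def CompatWithRat (ℓ : ℕ) (k : Type*) (l : Type*) {K L : Type*}
    [Field k] [Field K] [Algebra k K] [Field l] [Field L] [Algebra l L]
    (φ : K1 ℓ K ≃* K1 ℓ L) : Prop :=
  (∀ A : Subgroup (K1 ℓ K), IsRationalSubgroup ℓ k A →
     IsRationalSubgroup ℓ l (A.map φ.toMonoidHom)) ∧
  (∀ B : Subgroup (K1 ℓ L), IsRationalSubgroup ℓ l B →
     ∃ A : Subgroup (K1 ℓ K), IsRationalSubgroup ℓ k A ∧ A.map φ.toMonoidHom = B)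

/-- Two isomorphisms of perfect closures differ by a power of the Frobenius
(in characteristic `0`, they are equal). -/
def FrobTwistEquiv {Ki Li : Type*} [Field Ki] [Field Li] (σ σ' : Ki ≃+* Li) : Prop :=
  σ = σ' ∨ ∃ p : ℕ, p.Prime ∧ CharP Ki p ∧
    ((∃ n : ℕ, ∀ x, σ' x = σ (x ^ p ^ n)) ∨ (∃ n : ℕ, ∀ x, σ x = σ' (x ^ p ^ n)))

/-- A ring homomorphism `σ` acts on units, written additively, as a `ℤ`-linear map. -/
def unitsAddMap {K L : Type*} [Field K] [Field L] (σ : K →+* L) :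
    Additive Kˣ →ₗ[ℤ] Additive Lˣ :=
  (MonoidHom.toAdditive (Units.map σ.toMonoidHom)).toIntLinearMap

/-- The map on `n`-fold tensor powers of unit groups induced by a field homomorphism. -/
def milnorPreMap (n : ℕ) {K L : Type*} [Field K] [Field L] (σ : K →+* L) :
    MilnorPre n K →ₗ[ℤ] MilnorPre n L :=
  PiTensorProduct.map (fun _ => unitsAddMap σ)

lemma milnorPreMap_tprod {n : ℕ} {K L : Type*} [Field K] [Field L] (σ : K →+* L)
    (a : Fin n → Kˣ) :
    milnorPreMap n σ (PiTensorProduct.tprod ℤ (fun i => Additive.ofMul (a i))) =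
      PiTensorProduct.tprod ℤ (fun i => Additive.ofMul (Units.map σ.toMonoidHom (a i))) :=
  PiTensorProduct.map_tprod _ _

lemma steinbergRel_le_comap (n : ℕ) {K L : Type*} [Field K] [Field L] (σ : K →+* L) :
    SteinbergRel n K ≤ (SteinbergRel n L).comap (milnorPreMap n σ) := by
  refine Submodule.span_le.2 ?_
  rintro _ ⟨a, ⟨i, j, hij, h⟩, rfl⟩
  refine Submodule.subset_span ⟨fun i => Units.map σ.toMonoidHom (a i), ⟨i, j, hij, ?_⟩,
    milnorPreMap_tprod σ a⟩
  simpa using congrArg σ h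

/-- The map on Milnor K-groups induced by a field homomorphism. -/
def milnorKMap (n : ℕ) {K L : Type*} [Field K] [Field L] (σ : K →+* L) :
    MilnorK n K →ₗ[ℤ] MilnorK n L :=
  Submodule.mapQ _ _ (milnorPreMap n σ) (steinbergRel_le_comap n σ)

/-- The map on mod-`ℓ` Milnor K-groups induced by a field homomorphism. -/
def milnorKModMap (ℓ n : ℕ) {K L : Type*} [Field K] [Field L] (σ : K →+* L) :
    MilnorKMod ℓ n K →ₗ[ℤ] MilnorKMod ℓ n L :=
  Submodule.mapQ _ _ (milnorKMap n σ) <| by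
    rintro _ ⟨x, rfl⟩
    exact ⟨milnorKMap n σ x, by simp⟩

lemma milnorKModMap_symbol (ℓ : ℕ) {n : ℕ} {K L : Type*} [Field K] [Field L] (σ : K →+* L)
    (a : Fin n → Kˣ) :
    milnorKModMap ℓ n σ (milnorSymbol ℓ a) =
      milnorSymbol ℓ (fun i => Units.map σ.toMonoidHom (a i)) :=
  congrArg (fun x : MilnorPre n L =>
    (Submodule.Quotient.mk (Submodule.Quotient.mk x) : MilnorKMod ℓ n L))
    (milnorPreMap_tprod σ a)

lemma milnorKMod_hom_ext {ℓ n : ℕ} {K M : Type*} [Field K] [AddCommGroup M]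
    {f g : MilnorKMod ℓ n K →ₗ[ℤ] M}
    (h : ∀ a : Fin n → Kˣ, f (milnorSymbol ℓ a) = g (milnorSymbol ℓ a)) : f = g := by
  refine Submodule.linearMap_qext _ (Submodule.linearMap_qext _ (PiTensorProduct.ext ?_))
  exact MultilinearMap.ext fun a => h fun i => (a i).toMul

lemma milnorSymbol_pow (ℓ q : ℕ) {n : ℕ} {K : Type*} [Field K] (a : Fin n → Kˣ) :
    milnorSymbol ℓ (fun i => a i ^ q) = ((q : ℤ) ^ n) • milnorSymbol ℓ a := by
  have h := (PiTensorProduct.tprod ℤ (s := fun _ : Fin n => Additive Kˣ)).map_smul_univ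
    (fun _ => (q : ℤ)) (fun i => Additive.ofMul (a i))
  simp only [natCast_zsmul, ← ofMul_pow, Finset.prod_const, Finset.card_univ,
    Fintype.card_fin] at h
  exact congrArg (fun x : MilnorPre n K =>
    (Submodule.Quotient.mk (Submodule.Quotient.mk x) : MilnorKMod ℓ n K)) h

lemma zsmul_milnorKMod_eq_zero {ℓ n : ℕ} {K : Type*} [Field K] (x : MilnorKMod ℓ n K) :
    (ℓ : ℤ) • x = 0 := by
  obtain ⟨y, rfl⟩ := Submodule.Quotient.mk_surjective _ x
  rw [← Submodule.Quotient.mk_smul, Submodule.Quotient.mk_eq_zero]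
  exact ⟨y, rfl⟩

lemma zsmul_milnorKMod_bijective {ℓ n : ℕ} {K : Type*} [Field K] {m : ℤ}
    (hm : IsCoprime m (ℓ : ℤ)) :
    Function.Bijective (fun x : MilnorKMod ℓ n K => m • x) := by
  obtain ⟨u, v, huv⟩ := hm
  have key (x : MilnorKMod ℓ n K) : (u * m) • x = x := by
    have h := congrArg (· • x) huv
    simp only [add_smul, mul_smul v, zsmul_milnorKMod_eq_zero, smul_zero, add_zero,
      one_smul] at h
    exact h
  refine Function.bijective_iff_has_inverse.2 ⟨fun x => u • x, fun x => ?_, fun x => ?_⟩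
  · simpa only [mul_smul] using key x
  · simpa only [mul_comm u m, mul_smul] using key x

lemma milnorKModMap_comp_eq_smul (ℓ n q : ℕ) {K L : Type*} [Field K] [Field L]
    (σ : K →+* L) (τ : L →+* K) (h : ∀ x, τ (σ x) = x ^ q) (x : MilnorKMod ℓ n K) :
    milnorKModMap ℓ n τ (milnorKModMap ℓ n σ x) = ((q : ℤ) ^ n) • x := by
  suffices milnorKModMap ℓ n τ ∘ₗ milnorKModMap ℓ n σ = ((q : ℤ) ^ n) • LinearMap.id from
    LinearMap.congr_fun this x
  refine milnorKMod_hom_ext fun a => ?_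
  simp only [LinearMap.comp_apply, milnorKModMap_symbol, LinearMap.smul_apply, LinearMap.id_apply,
    ← milnorSymbol_pow]
  congr 1
  funext i
  ext
  simpa using h (a i)

lemma bijective_of_comp_bijective {α β : Type*} {f : α → β} {g : β → α} {s : α → α} {t : β → β}
    (hs : s.Bijective) (ht : t.Bijective) (hgf : ∀ x, g (f x) = s x) (hfg : ∀ y, f (g y) = t y) :
    f.Bijective :=
  ⟨fun x y h => hs.1 (by rw [← hgf, ← hgf, h]),
    fun y => let ⟨z, hz⟩ := ht.2 y; ⟨g z, (hfg z).trans hz⟩⟩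

lemma milnorKModMap_bijective {ℓ n q : ℕ} (hq : q.Coprime ℓ) {K L : Type*} [Field K] [Field L]
    (σ : K →+* L) (τ : L →+* K) (hτσ : ∀ x, τ (σ x) = x ^ q) (hστ : ∀ x, σ (τ x) = x ^ q) :
    Function.Bijective (milnorKModMap ℓ n σ) := by
  have hm : IsCoprime ((q : ℤ) ^ n) (ℓ : ℤ) := (Nat.isCoprime_iff_coprime.2 hq).pow_left
  exact bijective_of_comp_bijective (g := milnorKModMap ℓ n τ)
    (zsmul_milnorKMod_bijective hm) (zsmul_milnorKMod_bijective hm)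
    (milnorKModMap_comp_eq_smul ℓ n q σ τ hτσ) (milnorKModMap_comp_eq_smul ℓ n q τ σ hστ)

lemma coprime_expChar_of_ringChar_ne {ℓ : ℕ} (hℓ : ℓ.Prime) {K : Type*} [Field K]
    (hchar : ringChar K ≠ ℓ) (p : ℕ) [hp : ExpChar K p] : p.Coprime ℓ := by
  cases hp with
  | zero => exact Nat.coprime_one_left ℓ
  | prime hp' => exact (Nat.coprime_primes hp' hℓ).2 fun h => hchar (ringChar.eq K p ▸ h)

theorem statement_0 (ℓ : ℕ) (hℓ : ℓ.Prime)
    (K L : Type*) [Field K] [Field L] [Algebra K L]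
    (hchar : ringChar K ≠ ℓ)
    [FiniteDimensional K L] [IsPurelyInseparable K L] :
    ∀ n : ℕ, 1 ≤ n →
      ∃ φ : MilnorKMod ℓ n K →+ MilnorKMod ℓ n L,
        (∀ a : Fin n → Kˣ,
          φ (milnorSymbol ℓ a) =
            milnorSymbol ℓ (fun i => Units.map (algebraMap K L).toMonoidHom (a i))) ∧
        Function.Bijective φ := by
  intro n _
  obtain ⟨p, _⟩ := ExpChar.exists K
  let e := IsPurelyInseparable.exponent K L
  refine ⟨(milnorKModMap ℓ n (algebraMap K L)).toAddMonoidHom, milnorKModMap_symbol ℓ _, ?_⟩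
  exact milnorKModMap_bijective ((coprime_expChar_of_ringChar_ne hℓ hchar p).pow_left e)
    (algebraMap K L) (IsPurelyInseparable.iterateFrobenius K L p le_rfl)
    (IsPurelyInseparable.iterateFrobenius_algebraMap L p le_rfl)
    (IsPurelyInseparable.algebraMap_iterateFrobenius K p le_rfl)

end
end

section
/- Let ℓ be a prime and let K be a function field over an algebraically closed field k with char k ≠ ℓ, and set d := trdeg(K|k). Then k^M_s(K) = 0 for every s > d. -/
/-! Common definitions: mod-ℓ Milnor K-theory, K^×/(K^×)^ℓ, Ω_K, relative algebraic
closure, transcendence degree predicates, discrete valuations, etc. -/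

noncomputable section

open scoped TensorProduct

universe u v

/-- The defining relations of the mod-`ℓ` Milnor ring of a domain: symbols are additive on products
of nonzero elements and satisfy the homogeneous form of the Steinberg relation. -/
inductive MilnorRing.Rel (ℓ : ℕ) (D : Type*) [CommRing D] :
    FreeAlgebra ℤ D → FreeAlgebra ℤ D → Prop
  | zero : Rel ℓ D (FreeAlgebra.ι ℤ 0) 0
  | mul (a b : D) (ha : a ≠ 0) (hb : b ≠ 0) :
      Rel ℓ D (FreeAlgebra.ι ℤ (a * b)) (FreeAlgebra.ι ℤ a + FreeAlgebra.ι ℤ b)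
  | steinberg (a b : D) (ha : a ≠ 0) (hb : b ≠ 0) (hab : a + b ≠ 0) :
      Rel ℓ D ((FreeAlgebra.ι ℤ a - FreeAlgebra.ι ℤ (a + b)) *
        (FreeAlgebra.ι ℤ b - FreeAlgebra.ι ℤ (a + b))) 0
  | torsion : Rel ℓ D (ℓ : FreeAlgebra ℤ D) 0

/-- The total mod-`ℓ` Milnor K-ring of a domain, generated by symbols of nonzero elements. -/
def MilnorRing (ℓ : ℕ) (D : Type*) [CommRing D] : Type _ := RingQuot (MilnorRing.Rel ℓ D)

namespace MilnorRing

instance (ℓ : ℕ) (D : Type*) [CommRing D] : Ring (MilnorRing ℓ D) :=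
  inferInstanceAs (Ring (RingQuot (MilnorRing.Rel ℓ D)))

variable {ℓ : ℕ} {D : Type*} [CommRing D]

/-- The symbol of an element; the symbol of `0` is `0` by convention. -/
def sym (ℓ : ℕ) {D : Type*} [CommRing D] (a : D) : MilnorRing ℓ D :=
  RingQuot.mkRingHom (MilnorRing.Rel ℓ D) (FreeAlgebra.ι ℤ a)

theorem sym_zero : sym ℓ (0 : D) = 0 := by
  rw [sym, RingQuot.mkRingHom_rel (Rel.zero), map_zero]
  rfl

theorem sym_mul {a b : D} (ha : a ≠ 0) (hb : b ≠ 0) :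
    sym ℓ (a * b) = sym ℓ a + sym ℓ b := by
  rw [sym, RingQuot.mkRingHom_rel (Rel.mul a b ha hb), map_add]
  rfl

theorem steinberg {a b c : D} (ha : a ≠ 0) (hb : b ≠ 0) (hc : c ≠ 0) (h : a + b = c) :
    (sym ℓ a - sym ℓ c) * (sym ℓ b - sym ℓ c) = 0 := by
  subst h
  have := RingQuot.mkRingHom_rel (Rel.steinberg (ℓ := ℓ) a b ha hb hc)
  rw [map_mul, map_sub, map_sub, map_zero] at this
  exact this

theorem natCast_eq_zero : (ℓ : MilnorRing ℓ D) = 0 := by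
  have := RingQuot.mkRingHom_rel (Rel.torsion (ℓ := ℓ) (D := D))
  rw [map_natCast, map_zero] at this
  exact this

theorem ringHom_ext {R : Type*} [Ring R] {f g : MilnorRing ℓ D →+* R}
    (h : ∀ a, a ≠ 0 → f (sym ℓ a) = g (sym ℓ a)) : f = g := by
  refine RingQuot.ringQuot_ext (r := Rel ℓ D) f g ?_
  have : ((f.comp (RingQuot.mkRingHom (Rel ℓ D))).toIntAlgHom) =
      ((g.comp (RingQuot.mkRingHom (Rel ℓ D))).toIntAlgHom) := by
    refine FreeAlgebra.hom_ext (funext fun a => ?_)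
    by_cases ha : a = 0
    · subst ha
      change f (sym ℓ 0) = g (sym ℓ 0)
      rw [sym_zero, map_zero, map_zero]
    · exact h a ha
  exact RingHom.ext fun x => DFunLike.congr_fun this x

theorem induction {p : MilnorRing ℓ D → Prop} (zero : p 0) (one : p 1)
    (sym : ∀ a, a ≠ 0 → p (sym ℓ a)) (neg : ∀ x, p x → p (-x))
    (add : ∀ x y, p x → p y → p (x + y)) (mul : ∀ x y, p x → p y → p (x * y)) (x) : p x := by
  let S : Subring (MilnorRing ℓ D) :=
    { carrier := {x | p x}
      mul_mem' := fun {a b} ha hb => mul a b ha hb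
      one_mem' := one
      add_mem' := fun {a b} ha hb => add a b ha hb
      zero_mem' := zero
      neg_mem' := fun {a} ha => neg a ha }
  obtain ⟨y, rfl⟩ := RingQuot.mkRingHom_surjective (Rel ℓ D) x
  change RingQuot.mkRingHom (Rel ℓ D) y ∈ S
  induction y using FreeAlgebra.induction with
  | grade0 r =>
    rw [eq_intCast, map_intCast]
    exact intCast_mem S r
  | grade1 a =>
    by_cases ha : a = 0
    · subst ha
      change MilnorRing.sym ℓ 0 ∈ S
      rw [sym_zero]
      exact zero_mem S
    · exact sym a ha
  | mul a b ha hb => rw [map_mul]; exact mul_mem ha hb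
  | add a b ha hb => rw [map_add]; exact add_mem ha hb

/-- The universal property of the Milnor ring. -/
def lift {R : Type*} [Ring R] (φ : D → R) (zero : φ 0 = 0)
    (mul : ∀ a b, a ≠ 0 → b ≠ 0 → φ (a * b) = φ a + φ b)
    (steinberg : ∀ a b, a ≠ 0 → b ≠ 0 → a + b ≠ 0 →
      (φ a - φ (a + b)) * (φ b - φ (a + b)) = 0)
    (torsion : (ℓ : R) = 0) : MilnorRing ℓ D →+* R :=
  RingQuot.lift ⟨(FreeAlgebra.lift ℤ φ : FreeAlgebra ℤ D →ₐ[ℤ] R).toRingHom, by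
    intro x y h
    cases h with
    | zero => simp [zero]
    | mul a b ha hb => simp [mul a b ha hb]
    | steinberg a b ha hb hab => simp [steinberg a b ha hb hab]
    | torsion => simp [torsion]⟩

theorem lift_sym {R : Type*} [Ring R] {φ : D → R} (zero mul steinberg torsion) (a : D) :
    lift (ℓ := ℓ) φ zero mul steinberg torsion (sym ℓ a) = φ a :=
  (RingQuot.lift_mkRingHom_apply _ _ _).trans (by simp)

/-- Functoriality for injective ring homomorphisms. -/
def map (ℓ : ℕ) {D D' : Type*} [CommRing D] [CommRing D'] (f : D →+* D')
    (hf : Function.Injective f) : MilnorRing ℓ D →+* MilnorRing ℓ D' :=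
  lift (fun a => sym ℓ (f a)) (by simp [sym_zero])
    (fun a b ha hb => by
      rw [map_mul, sym_mul ((map_ne_zero_iff f hf).2 ha) ((map_ne_zero_iff f hf).2 hb)])
    (fun a b ha hb hab => steinberg ((map_ne_zero_iff f hf).2 ha)
      ((map_ne_zero_iff f hf).2 hb) ((map_ne_zero_iff f hf).2 hab) (map_add f a b).symm)
    natCast_eq_zero

theorem map_sym {D' : Type*} [CommRing D'] (f : D →+* D') (hf : Function.Injective f) (a : D) :
    map ℓ f hf (sym ℓ a) = sym ℓ (f a) :=
  lift_sym _ _ _ _ a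

theorem map_map {D' D'' : Type*} [CommRing D'] [CommRing D''] (f : D →+* D')
    (hf : Function.Injective f) (g : D' →+* D'') (hg : Function.Injective g) (h : D →+* D'')
    (hh : Function.Injective h) (hcomp : ∀ x, g (f x) = h x) (x : MilnorRing ℓ D) :
    map ℓ g hg (map ℓ f hf x) = map ℓ h hh x := by
  have : (map ℓ g hg).comp (map ℓ f hf) = map ℓ h hh :=
    ringHom_ext fun a _ => by simp [map_sym, hcomp]
  exact DFunLike.congr_fun this x

/-- The sign automorphism, multiplying each symbol by `-1`. -/
def sign : MilnorRing ℓ D →+* MilnorRing ℓ D :=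
  lift (fun a => - sym ℓ a) (by simp [sym_zero])
    (fun a b ha hb => by rw [sym_mul ha hb]; abel)
    (fun a b ha hb hab => by
      have := steinberg (ℓ := ℓ) ha hb hab rfl
      rw [← this]
      noncomm_ring) natCast_eq_zero

theorem sign_sym (a : D) : sign (sym ℓ a) = - sym ℓ a := lift_sym _ _ _ _ a

section Domain

variable [IsDomain D]

theorem sym_one : sym ℓ (1 : D) = 0 := by
  have := sym_mul (ℓ := ℓ) (one_ne_zero (α := D)) (one_ne_zero (α := D))
  rw [mul_one] at this
  exact left_eq_add.1 this

theorem sym_neg {a : D} (ha : a ≠ 0) : sym ℓ (-a) = sym ℓ a + sym ℓ (-1) := by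
  rw [← mul_neg_one, sym_mul ha (neg_ne_zero.2 one_ne_zero)]

theorem sym_neg_one_add_self : sym ℓ (-1 : D) + sym ℓ (-1) = 0 := by
  rw [← sym_neg (neg_ne_zero.2 one_ne_zero), neg_neg, sym_one]

theorem sym_pow {a : D} (ha : a ≠ 0) (n : ℕ) : sym ℓ (a ^ n) = n • sym ℓ a := by
  induction n with
  | zero => simp [sym_one]
  | succ n ih => rw [pow_succ, sym_mul (pow_ne_zero _ ha) ha, ih, succ_nsmul]

theorem sub_mul_sub_add {a b : D} (ha : a ≠ 0) (hb : b ≠ 0) :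
    (sym ℓ b - sym ℓ a) * (sym ℓ b - sym ℓ a + sym ℓ (-1)) = 0 := by
  by_cases hab : b = a
  · rw [hab, sub_self, zero_mul]
  have hc : b - a ≠ 0 := sub_ne_zero.2 hab
  have h1 := steinberg (ℓ := ℓ) ha hc hb (by ring)
  have h2 := steinberg (ℓ := ℓ) hb (neg_ne_zero.2 hc) ha (by ring)
  rw [sym_neg hc] at h2
  have : (sym ℓ b - sym ℓ a) * (sym ℓ b - sym ℓ a + sym ℓ (-1)) =
      (sym ℓ a - sym ℓ b) * (sym ℓ (b - a) - sym ℓ b) +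
        (sym ℓ b - sym ℓ a) * (sym ℓ (b - a) + sym ℓ (-1) - sym ℓ a) := by noncomm_ring
  rw [this, h1, h2, add_zero]

theorem sym_mul_self {a : D} (ha : a ≠ 0) : sym ℓ a * sym ℓ a = - (sym ℓ a * sym ℓ (-1)) := by
  have := sub_mul_sub_add (ℓ := ℓ) (one_ne_zero (α := D)) ha
  rw [sym_one, sub_zero, mul_add] at this
  exact eq_neg_of_add_eq_zero_left this

theorem sym_mul_sym_comm (a b : D) : sym ℓ a * sym ℓ b = - (sym ℓ b * sym ℓ a) := by
  by_cases ha : a = 0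
  · simp [ha, sym_zero]
  by_cases hb : b = 0
  · simp [hb, sym_zero]
  have h := sym_mul_self (ℓ := ℓ) (mul_ne_zero ha hb)
  have h1 := sym_mul_self (ℓ := ℓ) ha
  have h2 := sym_mul_self (ℓ := ℓ) hb
  rw [sym_mul ha hb, add_mul, mul_add, mul_add, add_mul, h1, h2] at h
  have : sym ℓ a * sym ℓ b + sym ℓ b * sym ℓ a = 0 := by
    have h' := sub_eq_zero.2 h
    rw [← h']
    abel
  exact eq_neg_of_add_eq_zero_left this

theorem sym_mul_eq_sign_mul (a : D) (x : MilnorRing ℓ D) : sym ℓ a * x = sign x * sym ℓ a := by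
  induction x using MilnorRing.induction with
  | zero => simp
  | one => simp
  | sym b hb => rw [sign_sym, sym_mul_sym_comm, neg_mul]
  | neg x hx => rw [mul_neg, hx, map_neg, neg_mul]
  | add x y hx hy => rw [mul_add, hx, hy, map_add, add_mul]
  | mul x y hx hy => rw [← mul_assoc, hx, mul_assoc, hy, map_mul, mul_assoc]

end Domain

end MilnorRing

/-- A discrete valuation on a domain together with an angular component map to its residue
domain. -/
structure Place (D κ : Type*) [CommRing D] [CommRing κ] where
  /-- the valuation -/
  ord : D → ℤ
  /-- the angular component -/
  ac : D → κ
  ac_ne_zero : ∀ f, f ≠ 0 → ac f ≠ 0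
  ord_mul : ∀ f g, f ≠ 0 → g ≠ 0 → ord (f * g) = ord f + ord g
  ac_mul : ∀ f g, f ≠ 0 → g ≠ 0 → ac (f * g) = ac f * ac g
  add_of_lt : ∀ f g, f ≠ 0 → g ≠ 0 → f + g ≠ 0 → ord f < ord g →
    ord (f + g) = ord f ∧ ac (f + g) = ac f
  add_of_eq : ∀ f g, f ≠ 0 → g ≠ 0 → f + g ≠ 0 → ord f = ord g →
    (ord (f + g) = ord f ∧ ac (f + g) = ac f + ac g) ∨ (ord f < ord (f + g) ∧ ac g = - ac f)

namespace Place

open MilnorRing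

variable {ℓ : ℕ} {D κ : Type*} [CommRing D] [IsDomain D] [CommRing κ] [IsDomain κ]

/-- The matrix which encodes the pair of a tame symbol and a specialisation. -/
def pairMatrix {R : Type*} [Ring R] (c U : R) (i : ℤ) : Matrix (Fin 2) (Fin 2) R :=
  !![U, 0; (i : R), -U + i * c]

theorem pairMatrix_add {R : Type*} [Ring R] (c U V : R) (i j : ℤ) :
    pairMatrix c U i + pairMatrix c V j = pairMatrix c (U + V) (i + j) := by
  ext a b
  fin_cases a <;> fin_cases b <;> simp [pairMatrix]
  noncomm_ring

theorem pairMatrix_sub {R : Type*} [Ring R] (c U V : R) (i j : ℤ) :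
    pairMatrix c U i - pairMatrix c V j = pairMatrix c (U - V) (i - j) := by
  ext a b
  fin_cases a <;> fin_cases b <;> simp [pairMatrix]
  noncomm_ring

theorem pairMatrix_mul_eq_zero {R : Type*} [Ring R] (c U : R) (i : ℤ) (hc : c + c = 0)
    (hU : U * (U + c) = 0) (hUc : U * c + c * U = 0) :
    pairMatrix c U i * pairMatrix c (U + c) i = 0 := by
  have h2 : ∀ j : ℤ, Even j → (j : R) * c = 0 := by
    rintro _ ⟨k, rfl⟩
    push_cast
    rw [add_mul, ← mul_add, hc, mul_zero]
  have h1 := h2 _ (Int.even_mul_succ_self i)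
  have h3 := h2 _ (Int.even_mul_pred_self i)
  push_cast at h1 h3
  have comm : ∀ x : R, x * (i : R) = i * x := fun x => (Int.cast_commute i x).symm
  have c1 : U * (i * c) = i * (U * c) := by rw [← mul_assoc, comm, mul_assoc]
  have c2 : c * (i * c) = i * (c * c) := by rw [← mul_assoc, comm, mul_assoc]
  ext a b
  fin_cases a <;> fin_cases b <;> simp [pairMatrix, Matrix.mul_apply, Fin.sum_univ_two]
  · exact hU
  · calc (i : R) * (U + c) + (-U + i * c) * i
        = i * U + i * c + (-(U * i) + i * (c * i)) := by noncomm_ring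
      _ = (i * (i + 1)) * c := by rw [comm, comm]; noncomm_ring
      _ = 0 := h1
  · calc (-U + i * c) * (-c + -U + i * c)
        = U * c + U * U - U * (i * c) - i * c * c - i * (c * U) + i * (c * (i * c)) := by
          noncomm_ring
      _ = U * (U + c) + (i * (i - 1) * c) * c - i * (U * c + c * U) := by
          rw [c1, c2]; noncomm_ring
      _ = 0 := by rw [hU, hUc, h3]; simp

theorem sym_sub_mul_sym_neg_one (a b : κ) :
    (sym ℓ b - sym ℓ a) * sym ℓ (-1 : κ) + sym ℓ (-1 : κ) * (sym ℓ b - sym ℓ a) = 0 := by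
  rw [mul_sub, sub_mul, sym_mul_sym_comm b, sym_mul_sym_comm a]
  abel

variable (P : Place D κ)

open Classical in
/-- The matrix attached to an element by a place. -/
def toMatrix (ℓ : ℕ) (f : D) : Matrix (Fin 2) (Fin 2) (MilnorRing ℓ κ) :=
  if f = 0 then 0 else pairMatrix (sym ℓ (-1)) (sym ℓ (P.ac f)) (P.ord f)

theorem toMatrix_of_ne {f : D} (hf : f ≠ 0) :
    P.toMatrix ℓ f = pairMatrix (sym ℓ (-1)) (sym ℓ (P.ac f)) (P.ord f) := if_neg hf

/-- The ring homomorphism encoding the tame symbol and the specialisation at a place. -/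
def symbolHom (ℓ : ℕ) (P : Place D κ) :
    MilnorRing ℓ D →+* Matrix (Fin 2) (Fin 2) (MilnorRing ℓ κ) :=
  lift (P.toMatrix ℓ) (if_pos rfl)
    (fun a b ha hb => by
      rw [P.toMatrix_of_ne ha, P.toMatrix_of_ne hb, P.toMatrix_of_ne (mul_ne_zero ha hb),
        pairMatrix_add, P.ord_mul a b ha hb, P.ac_mul a b ha hb,
        sym_mul (P.ac_ne_zero a ha) (P.ac_ne_zero b hb)])
    (fun a b ha hb hab => by
      have key : ∀ a b, a ≠ 0 → b ≠ 0 → a + b ≠ 0 → P.ord a < P.ord b →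
          P.toMatrix ℓ a - P.toMatrix ℓ (a + b) = 0 := by
        intro a b ha hb hab h
        obtain ⟨h1, h2⟩ := P.add_of_lt a b ha hb hab h
        rw [P.toMatrix_of_ne ha, P.toMatrix_of_ne hab, h1, h2, sub_self]
      rcases lt_trichotomy (P.ord a) (P.ord b) with h | h | h
      · rw [key a b ha hb hab h, zero_mul]
      · have hacb := P.ac_ne_zero b hb
        have haca := P.ac_ne_zero a ha
        have hacc := P.ac_ne_zero _ hab
        rw [P.toMatrix_of_ne ha, P.toMatrix_of_ne hb, P.toMatrix_of_ne hab]
        rcases P.add_of_eq a b ha hb hab h with ⟨h1, h2⟩ | ⟨h1, h2⟩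
        · have := steinberg (ℓ := ℓ) haca hacb hacc h2.symm
          rw [h1, ← h, pairMatrix_sub, pairMatrix_sub, sub_self]
          ext i j
          fin_cases i <;> fin_cases j <;> simp [pairMatrix, Matrix.mul_apply, Fin.sum_univ_two]
          · exact this
          · rw [← this]
            noncomm_ring
        · rw [h2, pairMatrix_sub, pairMatrix_sub, ← h, sym_neg haca,
            add_sub_right_comm]
          exact pairMatrix_mul_eq_zero _ _ _ sym_neg_one_add_self
            (sub_mul_sub_add hacc haca) (sym_sub_mul_sym_neg_one _ _)
      · rw [add_comm a b, key b a hb ha (by rwa [add_comm]) h, mul_zero])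
    (by
      ext i j
      rw [← Matrix.diagonal_natCast]
      fin_cases i <;> fin_cases j <;> simp [natCast_eq_zero])

theorem symbolHom_sym {f : D} (hf : f ≠ 0) :
    symbolHom ℓ P (sym ℓ f) = pairMatrix (sym ℓ (-1)) (sym ℓ (P.ac f)) (P.ord f) :=
  (lift_sym _ _ _ _ f).trans (P.toMatrix_of_ne hf)

theorem symbolHom_zero_one (z : MilnorRing ℓ D) : symbolHom ℓ P z 0 1 = 0 := by
  induction z using MilnorRing.induction with
  | zero => simp
  | one => simp
  | sym f hf => simp [symbolHom_sym P hf, pairMatrix]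
  | neg x hx => simp [hx]
  | add x y hx hy => simp [hx, hy]
  | mul x y hx hy => simp [Matrix.mul_apply, Fin.sum_univ_two, hx, hy]

/-- The tame symbol. -/
def tame (ℓ : ℕ) (P : Place D κ) : MilnorRing ℓ D →+ MilnorRing ℓ κ where
  toFun z := symbolHom ℓ P z 1 0
  map_zero' := by simp
  map_add' := by simp

/-- The specialisation homomorphism. -/
def spec (ℓ : ℕ) (P : Place D κ) : MilnorRing ℓ D →+* MilnorRing ℓ κ where
  toFun z := symbolHom ℓ P z 0 0
  map_zero' := by simp
  map_one' := by simp
  map_add' := by simp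
  map_mul' x y := by simp [Matrix.mul_apply, Fin.sum_univ_two, symbolHom_zero_one]

theorem spec_sym {f : D} (hf : f ≠ 0) : spec ℓ P (sym ℓ f) = sym ℓ (P.ac f) := by
  change symbolHom ℓ P _ 0 0 = _
  rw [symbolHom_sym P hf]
  rfl

theorem tame_sym_mul {f : D} (hf : f ≠ 0) (z : MilnorRing ℓ D) :
    tame ℓ P (sym ℓ f * z) = P.ord f • spec ℓ P z +
      (-sym ℓ (P.ac f) + P.ord f • sym ℓ (-1)) * tame ℓ P z := by
  change symbolHom ℓ P _ 1 0 = P.ord f • symbolHom ℓ P z 0 0 + _ * symbolHom ℓ P z 1 0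
  rw [map_mul, symbolHom_sym P hf]
  simp [Matrix.mul_apply, Fin.sum_univ_two, pairMatrix]

theorem tame_one : tame ℓ P 1 = 0 := by
  change symbolHom ℓ P 1 1 0 = 0
  simp

theorem tame_sym {f : D} (hf : f ≠ 0) : tame ℓ P (sym ℓ f) = P.ord f := by
  have := tame_sym_mul (ℓ := ℓ) P hf 1
  rw [mul_one, tame_one, map_one, mul_zero, add_zero, zsmul_one] at this
  exact this

theorem tame_mul_of_tame_eq_zero {x y : MilnorRing ℓ D} (hx : tame ℓ P x = 0)
    (hy : tame ℓ P y = 0) : tame ℓ P (x * y) = 0 := by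
  change symbolHom ℓ P x 1 0 = 0 at hx
  change symbolHom ℓ P y 1 0 = 0 at hy
  change symbolHom ℓ P (x * y) 1 0 = 0
  rw [map_mul, Matrix.mul_apply, Fin.sum_univ_two, hx, hy, zero_mul, mul_zero, add_zero]

end Place

namespace Place

section OfPrime

variable {D κ : Type*} [CommRing D] [IsDomain D] [CommRing κ] [IsDomain κ]

open Classical in
/-- The cofactor of the maximal power of `p` dividing `f`. -/
def cofactor (p f : D) : D :=
  if h : ∃ q, f = p ^ multiplicity p f * q then h.choose else 0

theorem multiplicity_pow_mul {p q : D} (hp : Prime p) (hq : ¬ p ∣ q) (m : ℕ) :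
    multiplicity p (p ^ m * q) = m := by
  refine multiplicity_eq_of_dvd_of_not_dvd (dvd_mul_right _ _) fun h => hq ?_
  rw [pow_succ] at h
  exact (mul_dvd_mul_iff_left (pow_ne_zero m hp.ne_zero)).1 h

theorem cofactor_pow_mul {p q : D} (hp : Prime p) (hq : ¬ p ∣ q) (m : ℕ) :
    cofactor p (p ^ m * q) = q := by
  have h : ∃ q', p ^ m * q = p ^ multiplicity p (p ^ m * q) * q' :=
    ⟨q, by rw [multiplicity_pow_mul hp hq]⟩
  rw [cofactor, dif_pos h]
  have := h.choose_spec
  generalize h.choose = q' at this ⊢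
  rw [multiplicity_pow_mul hp hq] at this
  exact (mul_left_cancel₀ (pow_ne_zero m hp.ne_zero) this).symm

/-- The place attached to a prime element. -/
def ofPrime (p : D) (hp : Prime p) (hfin : ∀ f : D, f ≠ 0 → FiniteMultiplicity p f)
    (r : D →+* κ) (hr : ∀ x, r x = 0 ↔ p ∣ x) : Place D κ where
  ord f := multiplicity p f
  ac f := r (cofactor p f)
  ac_ne_zero f hf := by
    obtain ⟨q, hq, hpq⟩ := (hfin f hf).exists_eq_pow_mul_and_not_dvd
    rw [hq, cofactor_pow_mul hp hpq, Ne, hr]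
    exact hpq
  ord_mul f g hf hg := by
    exact_mod_cast multiplicity_mul hp (hfin _ (mul_ne_zero hf hg))
  ac_mul f g hf hg := by
    obtain ⟨q, hq, hpq⟩ := (hfin f hf).exists_eq_pow_mul_and_not_dvd
    obtain ⟨s, hs, hps⟩ := (hfin g hg).exists_eq_pow_mul_and_not_dvd
    have : ¬ p ∣ q * s := fun h => (hp.dvd_or_dvd h).elim hpq hps
    rw [hq, hs, mul_mul_mul_comm, ← pow_add, cofactor_pow_mul hp this, cofactor_pow_mul hp hpq,
      cofactor_pow_mul hp hps, map_mul]
  add_of_lt f g hf hg hfg h := by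
    obtain ⟨q, hq, hpq⟩ := (hfin f hf).exists_eq_pow_mul_and_not_dvd
    obtain ⟨s, hs, hps⟩ := (hfin g hg).exists_eq_pow_mul_and_not_dvd
    generalize multiplicity p f = a at *
    generalize multiplicity p g = b at *
    obtain ⟨e, rfl⟩ := Nat.exists_eq_add_of_lt (Nat.cast_lt.1 h)
    have h1 : p ∣ p ^ (e + 1) * s := dvd_mul_of_dvd_left (dvd_pow_self p e.succ_ne_zero) s
    have h2 : ¬ p ∣ q + p ^ (e + 1) * s := fun h => hpq ((dvd_add_left h1).1 h)
    have h3 : f + g = p ^ a * (q + p ^ (e + 1) * s) := by rw [hq, hs]; ring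
    rw [h3, multiplicity_pow_mul hp h2, cofactor_pow_mul hp h2, hq, cofactor_pow_mul hp hpq,
      map_add, (hr _).2 h1, add_zero]
    exact ⟨rfl, rfl⟩
  add_of_eq f g hf hg hfg h := by
    obtain ⟨q, hq, hpq⟩ := (hfin f hf).exists_eq_pow_mul_and_not_dvd
    obtain ⟨s, hs, hps⟩ := (hfin g hg).exists_eq_pow_mul_and_not_dvd
    rw [Nat.cast_inj] at h
    rw [← h] at hs
    generalize multiplicity p f = a at *
    have h3 : f + g = p ^ a * (q + s) := by rw [hq, hs]; ring
    have hqs : q + s ≠ 0 := fun h => hfg (by rw [h3, h, mul_zero])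
    by_cases hdvd : p ∣ q + s
    · right
      obtain ⟨t, ht, hpt⟩ := (hfin _ hqs).exists_eq_pow_mul_and_not_dvd
      have hpos : 0 < multiplicity p (q + s) :=
        Nat.pos_of_ne_zero fun h0 => by
          rw [h0, pow_zero, one_mul] at ht
          exact hpt (ht ▸ hdvd)
      rw [ht, ← mul_assoc, ← pow_add] at h3
      refine ⟨?_, ?_⟩
      · rw [h3, multiplicity_pow_mul hp hpt]
        omega
      · rw [hq, hs, cofactor_pow_mul hp hpq, cofactor_pow_mul hp hps]
        rw [← hr, map_add] at hdvd
        exact eq_neg_of_add_eq_zero_right hdvd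
    · left
      rw [h3, multiplicity_pow_mul hp hdvd, cofactor_pow_mul hp hdvd, hq, hs,
        cofactor_pow_mul hp hpq, cofactor_pow_mul hp hps, map_add]
      exact ⟨rfl, rfl⟩

theorem ofPrime_of_not_dvd (p : D) (hp : Prime p) (hfin : ∀ f : D, f ≠ 0 → FiniteMultiplicity p f)
    (r : D →+* κ) (hr : ∀ x, r x = 0 ↔ p ∣ x) {f : D} (hf : ¬ p ∣ f) :
    (ofPrime p hp hfin r hr).ord f = 0 ∧ (ofPrime p hp hfin r hr).ac f = r f := by
  have h1 := multiplicity_pow_mul hp hf 0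
  have h2 := cofactor_pow_mul hp hf 0
  rw [pow_zero, one_mul] at h1 h2
  exact ⟨by simp [ofPrime, h1], by simp [ofPrime, h2]⟩

theorem ofPrime_self (p : D) (hp : Prime p) (hfin : ∀ f : D, f ≠ 0 → FiniteMultiplicity p f)
    (r : D →+* κ) (hr : ∀ x, r x = 0 ↔ p ∣ x) :
    (ofPrime p hp hfin r hr).ord p = 1 ∧ (ofPrime p hp hfin r hr).ac p = 1 := by
  have h1 := multiplicity_pow_mul hp (fun h => hp.not_isUnit (isUnit_of_dvd_one h)) 1
  have h2 := cofactor_pow_mul hp (fun h => hp.not_isUnit (isUnit_of_dvd_one h)) 1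
  rw [pow_one, mul_one] at h1 h2
  exact ⟨by simp [ofPrime], by simp [ofPrime, h2]⟩

end OfPrime

open Polynomial

variable {L : Type*} [Field L]

/-- The place at infinity of a polynomial ring. -/
def infty (L : Type*) [Field L] : Place L[X] L where
  ord f := -(f.natDegree : ℤ)
  ac f := f.leadingCoeff
  ac_ne_zero f hf := leadingCoeff_ne_zero.2 hf
  ord_mul f g hf hg := by
    rw [natDegree_mul hf hg]
    push_cast
    ring
  ac_mul f g _ _ := leadingCoeff_mul f g
  add_of_lt f g hf hg _ h := by
    have h1 : g.natDegree < f.natDegree := by omega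
    exact ⟨by rw [natDegree_add_eq_left_of_natDegree_lt h1],
      leadingCoeff_add_of_degree_lt' (degree_lt_degree h1)⟩
  add_of_eq f g hf hg hfg h := by
    have h1 : f.natDegree = g.natDegree := by omega
    by_cases h0 : f.leadingCoeff + g.leadingCoeff = 0
    · right
      refine ⟨?_, eq_neg_of_add_eq_zero_right h0⟩
      have h2 : (f + g).coeff f.natDegree = 0 := by
        rw [coeff_add]
        nth_rw 2 [h1]
        exact h0
      have h3 : (f + g).natDegree ≤ f.natDegree := by
        simpa [h1] using natDegree_add_le f g
      have h4 : (f + g).natDegree ≠ f.natDegree := fun h => hfg (by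
        rw [← h] at h2
        exact leadingCoeff_eq_zero.1 h2)
      omega
    · left
      have h2 : f.degree = g.degree := by
        rw [degree_eq_natDegree hf, degree_eq_natDegree hg, h1]
      have h3 := leadingCoeff_add_of_degree_eq h2 h0
      refine ⟨?_, h3⟩
      have h4 : (f + g).degree = g.degree := by
        rw [degree_add_eq_of_leadingCoeff_add_ne_zero h0, h2, max_self]
      rw [natDegree_eq_of_degree_eq h4, h1]

/-- Monic irreducible polynomials, which index the finite places of a polynomial ring. -/
abbrev Finite (L : Type*) [Field L] : Type _ := {v : L[X] // v.Monic ∧ Irreducible v}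

instance (v : Finite L) : Fact (Irreducible v.1) := ⟨v.2.2⟩

/-- The place of a polynomial ring attached to a monic irreducible polynomial. -/
def ofIrreducible (v : Finite L) : Place L[X] (AdjoinRoot v.1) :=
  ofPrime v.1 v.2.2.prime
    (fun _ hf => FiniteMultiplicity.of_not_isUnit v.2.2.not_isUnit hf)
    (AdjoinRoot.mk v.1) fun _ => AdjoinRoot.mk_eq_zero

theorem ofIrreducible_of_natDegree_lt (v : Finite L) {f : L[X]} (hf : f ≠ 0)
    (h : f.natDegree < v.1.natDegree) :
    (ofIrreducible v).ord f = 0 ∧ (ofIrreducible v).ac f = AdjoinRoot.mk v.1 f :=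
  ofPrime_of_not_dvd _ _ _ _ _ (not_dvd_of_natDegree_lt hf h)

theorem ofIrreducible_self (v : Finite L) :
    (ofIrreducible v).ord v.1 = 1 ∧ (ofIrreducible v).ac v.1 = 1 :=
  ofPrime_self _ _ _ _ _

theorem ofIrreducible_of_not_dvd (v : Finite L) {f : L[X]} (h : ¬ v.1 ∣ f) :
    (ofIrreducible v).ord f = 0 ∧ (ofIrreducible v).ac f = AdjoinRoot.mk v.1 f :=
  ofPrime_of_not_dvd _ _ _ _ _ h

theorem not_dvd_of_ne {v w : Finite L} (h : v ≠ w) : ¬ v.1 ∣ w.1 := fun hd =>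
  h (Subtype.ext (eq_of_monic_of_associated v.2.1 w.2.1
    ((v.2.2.dvd_irreducible_iff_associated w.2.2).1 hd)))

end Place

namespace MilnorRing

open Polynomial Place

variable {ℓ : ℕ} {L : Type*} [Field L]

/-- The subring generated by symbols of polynomials of degree less than `n`. -/
def low (ℓ : ℕ) (L : Type*) [Field L] (n : ℕ) : Subring (MilnorRing ℓ L[X]) :=
  Subring.closure {x | ∃ g : L[X], g ≠ 0 ∧ g.natDegree < n ∧ sym ℓ g = x}

theorem sym_mem_low {n : ℕ} {g : L[X]} (h : g.natDegree < n) : sym ℓ g ∈ low ℓ L n := by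
  by_cases hg : g = 0
  · rw [hg, sym_zero]
    exact zero_mem _
  · exact Subring.subset_closure ⟨g, hg, h, rfl⟩

theorem low_induction {n : ℕ} {p : MilnorRing ℓ L[X] → Prop} (zero : p 0) (one : p 1)
    (sym : ∀ g : L[X], g ≠ 0 → g.natDegree < n → p (sym ℓ g)) (neg : ∀ x, p x → p (-x))
    (add : ∀ x y, p x → p y → p (x + y)) (mul : ∀ x y, p x → p y → p (x * y))
    {x : MilnorRing ℓ L[X]} (hx : x ∈ low ℓ L n) : p x := by
  induction hx using Subring.closure_induction with
  | mem x h =>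
    obtain ⟨g, hg, hgn, rfl⟩ := h
    exact sym g hg hgn
  | zero => exact zero
  | one => exact one
  | add x y _ _ hx hy => exact add x y hx hy
  | neg x _ hx => exact neg x hx
  | mul x y _ _ hx hy => exact mul x y hx hy

theorem sign_mem_low {n : ℕ} {x : MilnorRing ℓ L[X]} (hx : x ∈ low ℓ L n) :
    sign x ∈ low ℓ L n := by
  refine low_induction (p := fun x => sign x ∈ low ℓ L n) ?_ ?_ ?_ ?_ ?_ ?_ hx
  · simp
  · simp
  · intro g _ h
    rw [sign_sym]
    exact neg_mem (sym_mem_low h)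
  · intro x h
    rw [map_neg]
    exact neg_mem h
  · intro x y hx hy
    rw [map_add]
    exact add_mem hx hy
  · intro x y hx hy
    rw [map_mul]
    exact mul_mem hx hy

theorem tame_eq_zero_of_mem_low {v : Place.Finite L} {n : ℕ} (hn : n ≤ v.1.natDegree)
    {z : MilnorRing ℓ L[X]} (hz : z ∈ low ℓ L n) : tame ℓ (ofIrreducible v) z = 0 := by
  refine low_induction (p := fun z => tame ℓ (ofIrreducible v) z = 0) ?_ ?_ ?_ ?_ ?_ ?_ hz
  · exact map_zero _
  · exact tame_one _
  · intro g hg h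
    rw [tame_sym _ hg, (ofIrreducible_of_natDegree_lt v hg (h.trans_le hn)).1, Int.cast_zero]
  · intro x hx
    rw [map_neg, hx, neg_zero]
  · intro x y hx hy
    rw [map_add, hx, hy, add_zero]
  · intro x y hx hy
    exact tame_mul_of_tame_eq_zero _ hx hy

theorem finite_tame_ne_zero (z : MilnorRing ℓ L[X]) :
    {v : Place.Finite L | tame ℓ (ofIrreducible v) z ≠ 0}.Finite := by
  induction z using MilnorRing.induction with
  | zero => simp
  | one => simp [tame_one]
  | sym f hf =>
    classical
    refine ((UniqueFactorizationMonoid.normalizedFactors f).toFinset.finite_toSet.preimage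
      Subtype.val_injective.injOn).subset fun v hv => ?_
    simp only [Set.mem_preimage, Finset.mem_coe, Multiset.mem_toFinset]
    rw [UniqueFactorizationMonoid.mem_normalizedFactors_iff' hf]
    refine ⟨v.2.2, v.2.1.normalize_eq_self, ?_⟩
    by_contra hd
    refine hv ?_
    rw [tame_sym _ hf, (ofIrreducible_of_not_dvd v hd).1, Int.cast_zero]
  | neg x hx => simpa using hx
  | add x y hx hy =>
    refine (hx.union hy).subset fun v hv => ?_
    by_contra h
    simp only [Set.mem_union, Set.mem_ofPred_eq, not_or, not_not] at h
    exact hv (by rw [map_add, h.1, h.2, add_zero])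
  | mul x y hx hy =>
    refine (hx.union hy).subset fun v hv => ?_
    by_contra h
    simp only [Set.mem_union, Set.mem_ofPred_eq, not_or, not_not] at h
    exact hv (tame_mul_of_tame_eq_zero _ h.1 h.2)

/-- The sum over all finite places of the images of the tame symbols. -/
def finiteSum (N : ∀ v : Place.Finite L, MilnorRing ℓ (AdjoinRoot v.1) →+ MilnorRing ℓ L) :
    MilnorRing ℓ L[X] →+ MilnorRing ℓ L where
  toFun z := ∑ᶠ v, N v (tame ℓ (ofIrreducible v) z)
  map_zero' := by simp
  map_add' x y := by
    rw [← finsum_add_distrib]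
    · simp
    · exact (finite_tame_ne_zero x).subset fun v hv h => hv (by simp [h])
    · exact (finite_tame_ne_zero y).subset fun v hv h => hv (by simp [h])

theorem finiteSum_add (N N' : ∀ v : Place.Finite L, MilnorRing ℓ (AdjoinRoot v.1) →+ MilnorRing ℓ L)
    (z : MilnorRing ℓ L[X]) :
    finiteSum (fun v => N v + N' v) z = finiteSum N z + finiteSum N' z := by
  change ∑ᶠ v, _ = ∑ᶠ v, _ + ∑ᶠ v, _
  rw [← finsum_add_distrib]
  · simp
  · exact (finite_tame_ne_zero z).subset fun v hv h => hv (by simp [h])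
  · exact (finite_tame_ne_zero z).subset fun v hv h => hv (by simp [h])

/-- Congruence modulo elements that stay in the subring of lower degree after multiplication by the
symbol of `v`. -/
def residueCon (ℓ : ℕ) (v : Place.Finite L) : RingCon (low ℓ L v.1.natDegree) where
  r z w := sym ℓ v.1 * (z.1 - w.1) ∈ low ℓ L v.1.natDegree
  iseqv :=
    { refl := fun z => by simp
      symm := fun {z w} h => by
        have := neg_mem h
        rwa [← mul_neg, neg_sub] at this
      trans := fun {x y z} h1 h2 => by
        have := add_mem h1 h2
        rwa [← mul_add, sub_add_sub_cancel] at this }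
  mul' {z z' w w'} h1 h2 := by
    have e : sym ℓ v.1 * (z.1 * w.1 - z'.1 * w'.1) =
        sym ℓ v.1 * (z.1 - z'.1) * w.1 + sym ℓ v.1 * z'.1 * (w.1 - w'.1) := by noncomm_ring
    have := add_mem (mul_mem h1 w.2) (mul_mem (sign_mem_low z'.2) h2)
    rw [← mul_assoc, ← sym_mul_eq_sign_mul, ← e] at this
    exact this
  add' {z z' w w'} h1 h2 := by
    have := add_mem h1 h2
    rwa [← mul_add, sub_add_sub_comm] at this

theorem natDegree_modByMonicHom_lt (v : Place.Finite L) (x : AdjoinRoot v.1) :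
    (AdjoinRoot.modByMonicHom v.2.1 x).natDegree < v.1.natDegree := by
  obtain ⟨f, rfl⟩ := AdjoinRoot.mk_surjective x
  rw [AdjoinRoot.modByMonicHom_mk]
  exact natDegree_modByMonic_lt _ v.2.1 v.2.2.ne_one

/-- The symbol of the canonical representative of a residue class. -/
def repSym (ℓ : ℕ) (v : Place.Finite L) (x : AdjoinRoot v.1) : low ℓ L v.1.natDegree :=
  ⟨sym ℓ (AdjoinRoot.modByMonicHom v.2.1 x), sym_mem_low (natDegree_modByMonicHom_lt v x)⟩

theorem repSym_mul (v : Place.Finite L) {x y : AdjoinRoot v.1} (hx : x ≠ 0) (hy : y ≠ 0) :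
    residueCon ℓ v (repSym ℓ v (x * y)) (repSym ℓ v x + repSym ℓ v y) := by
  change sym ℓ v.1 * (sym ℓ (AdjoinRoot.modByMonicHom v.2.1 (x * y)) -
    (sym ℓ (AdjoinRoot.modByMonicHom v.2.1 x) + sym ℓ (AdjoinRoot.modByMonicHom v.2.1 y))) ∈ _
  have hg := natDegree_modByMonicHom_lt v x
  have hh := natDegree_modByMonicHom_lt v y
  have hf := natDegree_modByMonicHom_lt v (x * y)
  have ne : ∀ z : AdjoinRoot v.1, z ≠ 0 → AdjoinRoot.modByMonicHom v.2.1 z ≠ 0 := fun z hz h =>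
    hz (by rw [← AdjoinRoot.mk_leftInverse v.2.1 z, h, map_zero])
  have hxy := ne _ (mul_ne_zero hx hy)
  replace hx := ne x hx
  replace hy := ne y hy
  have e : AdjoinRoot.modByMonicHom v.2.1 (x * y) =
      (AdjoinRoot.modByMonicHom v.2.1 x * AdjoinRoot.modByMonicHom v.2.1 y) %ₘ v.1 := by
    rw [← AdjoinRoot.modByMonicHom_mk v.2.1, map_mul (AdjoinRoot.mk v.1), AdjoinRoot.mk_leftInverse v.2.1,
      AdjoinRoot.mk_leftInverse v.2.1]
  generalize AdjoinRoot.modByMonicHom v.2.1 x = g at *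
  generalize AdjoinRoot.modByMonicHom v.2.1 y = h at *
  generalize AdjoinRoot.modByMonicHom v.2.1 (x * y) = f at *
  have e2 := modByMonic_add_div (g * h) v.1
  rw [← e] at e2
  by_cases hq : (g * h) /ₘ v.1 = 0
  · rw [hq, mul_zero, add_zero] at e2
    rw [e2, sym_mul hx hy, sub_self, mul_zero]
    exact zero_mem _
  · have hqd : ((g * h) /ₘ v.1).natDegree < v.1.natDegree := by
      rw [natDegree_divByMonic _ v.2.1, natDegree_mul hx hy]
      omega
    generalize (g * h) /ₘ v.1 = q at *
    have st := steinberg (ℓ := ℓ) hxy (mul_ne_zero v.2.2.ne_zero hq) (mul_ne_zero hx hy) e2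
    rw [sym_mul v.2.2.ne_zero hq, sym_mul hx hy] at st
    have mem : (sym ℓ f - (sym ℓ g + sym ℓ h)) * (sym ℓ q - (sym ℓ g + sym ℓ h)) ∈
        low ℓ L v.1.natDegree :=
      mul_mem (sub_mem (sym_mem_low hf) (add_mem (sym_mem_low hg) (sym_mem_low hh)))
        (sub_mem (sym_mem_low hqd) (add_mem (sym_mem_low hg) (sym_mem_low hh)))
    rw [sym_mul_eq_sign_mul]
    simp only [map_sub, map_add, sign_sym]
    have : (-sym ℓ f - (-sym ℓ g + -sym ℓ h)) * sym ℓ v.1 =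
      (sym ℓ f - (sym ℓ g + sym ℓ h)) * (sym ℓ q - (sym ℓ g + sym ℓ h)) -
      (sym ℓ f - (sym ℓ g + sym ℓ h)) * (sym ℓ v.1 + sym ℓ q - (sym ℓ g + sym ℓ h)) := by
      noncomm_ring
    rw [this, st, sub_zero]
    exact mem

/-- Lifting of residue symbols to symbols of polynomials of lower degree. -/
def residueHom (ℓ : ℕ) (v : Place.Finite L) :
    MilnorRing ℓ (AdjoinRoot v.1) →+* (residueCon ℓ v).Quotient :=
  lift (fun x => (residueCon ℓ v).mk' (repSym ℓ v x))
    (by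
      have : repSym ℓ v 0 = 0 := Subtype.ext (by simp [repSym, sym_zero])
      rw [this, map_zero])
    (fun x y hx hy => by
      rw [← map_add]
      exact (RingCon.eq _).2 (repSym_mul v hx hy))
    (fun x y hx hy hxy => by
      have ne : ∀ z : AdjoinRoot v.1, z ≠ 0 → AdjoinRoot.modByMonicHom v.2.1 z ≠ 0 :=
        fun z hz h => hz (by rw [← AdjoinRoot.mk_leftInverse v.2.1 z, h, map_zero])
      rw [← map_sub, ← map_sub, ← map_mul]
      convert map_zero (residueCon ℓ v).mk'
      refine Subtype.ext ?_
      exact steinberg (ne _ hx) (ne _ hy) (ne _ hxy) (map_add _ x y).symm)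
    (by
      rw [← map_natCast (residueCon ℓ v).mk']
      convert map_zero (residueCon ℓ v).mk'
      exact Subtype.ext (by simp [natCast_eq_zero]))

theorem residueHom_spec (v : Place.Finite L) {z : MilnorRing ℓ L[X]}
    (hz : z ∈ low ℓ L v.1.natDegree) :
    residueHom ℓ v (spec ℓ (ofIrreducible v) z) = (residueCon ℓ v).mk' ⟨z, hz⟩ := by
  induction hz using Subring.closure_induction with
  | mem x h =>
    obtain ⟨g, hg, hgn, rfl⟩ := h
    rw [spec_sym _ hg, (ofIrreducible_of_natDegree_lt v hg hgn).2]
    refine (lift_sym _ _ _ _ _).trans ?_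
    congr 1
    refine Subtype.ext ?_
    change sym ℓ (AdjoinRoot.modByMonicHom v.2.1 (AdjoinRoot.mk v.1 g)) = sym ℓ g
    rw [AdjoinRoot.modByMonicHom_mk, (modByMonic_eq_self_iff v.2.1).2 (degree_lt_degree hgn)]
  | zero => simp only [map_zero]; rfl
  | one => simp only [map_one]; rfl
  | add x y _ _ hx hy => rw [map_add, map_add, hx, hy]; rfl
  | neg x _ hx => rw [map_neg, map_neg, hx]; rfl
  | mul x y _ _ hx hy => rw [map_mul, map_mul, hx, hy]; rfl

theorem exists_residue_factor (v : Place.Finite L) (f : MilnorRing ℓ L[X] →+ MilnorRing ℓ L)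
    (hf : ∀ z ∈ low ℓ L v.1.natDegree, f z = 0) :
    ∃ N : MilnorRing ℓ (AdjoinRoot v.1) →+ MilnorRing ℓ L, ∀ z ∈ low ℓ L v.1.natDegree,
      N (spec ℓ (ofIrreducible v) z) = f (sym ℓ v.1 * z) := by
  let F : (residueCon ℓ v).Quotient →+ MilnorRing ℓ L :=
    { toFun := Quotient.lift (fun z => f (sym ℓ v.1 * z.1)) fun z w h => by
        rw [← sub_eq_zero, ← map_sub, ← mul_sub]
        exact hf _ h
      map_zero' := by
        change f (sym ℓ v.1 * 0) = 0
        rw [mul_zero, map_zero]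
      map_add' := by
        rintro ⟨x⟩ ⟨y⟩
        change f (sym ℓ v.1 * (x.1 + y.1)) = f (sym ℓ v.1 * x.1) + f (sym ℓ v.1 * y.1)
        rw [mul_add, map_add] }
  refine ⟨F.comp (residueHom ℓ v).toAddMonoidHom, fun z hz => ?_⟩
  change F (residueHom ℓ v _) = _
  rw [residueHom_spec v hz]
  rfl

end MilnorRing

namespace MilnorRing

open Polynomial Place

variable {ℓ : ℕ} {L : Type*} [Field L]

/-- The additive group generated by the symbols of degree less than `n` and their multiples by
symbols of monic irreducible polynomials of degree `n`. -/
def lowSpan (ℓ : ℕ) (L : Type*) [Field L] (n : ℕ) : AddSubgroup (MilnorRing ℓ L[X]) :=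
  AddSubgroup.closure ({x | x ∈ low ℓ L n} ∪
    {x | ∃ v : Place.Finite L, v.1.natDegree = n ∧ ∃ z ∈ low ℓ L n, sym ℓ v.1 * z = x})

theorem mem_lowSpan_of_mem_low {n : ℕ} {z : MilnorRing ℓ L[X]} (hz : z ∈ low ℓ L n) :
    z ∈ lowSpan ℓ L n :=
  AddSubgroup.subset_closure (Or.inl hz)

theorem sym_mul_mem_lowSpan {v : Place.Finite L} {n : ℕ} (hv : v.1.natDegree = n)
    {z : MilnorRing ℓ L[X]} (hz : z ∈ low ℓ L n) : sym ℓ v.1 * z ∈ lowSpan ℓ L n :=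
  AddSubgroup.subset_closure (Or.inr ⟨v, hv, z, hz, rfl⟩)

theorem sym_mul_mem_lowSpan_of_lt {n : ℕ} {g : L[X]} (hg : g.natDegree < n)
    {s : MilnorRing ℓ L[X]} (hs : s ∈ lowSpan ℓ L n) : sym ℓ g * s ∈ lowSpan ℓ L n := by
  induction hs using AddSubgroup.closure_induction with
  | mem x h =>
    rcases h with h | ⟨v, hv, z, hz, rfl⟩
    · exact mem_lowSpan_of_mem_low (mul_mem (sym_mem_low hg) h)
    · rw [← mul_assoc, sym_mul_sym_comm, neg_mul, mul_assoc]
      exact neg_mem (sym_mul_mem_lowSpan hv (mul_mem (sym_mem_low hg) hz))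
  | zero => simp
  | add x y _ _ hx hy => rw [mul_add]; exact add_mem hx hy
  | neg x _ hx => rw [mul_neg]; exact neg_mem hx

theorem sym_mul_mem_lowSpan_of_irreducible {n : ℕ} (hn : 1 ≤ n) {w : Place.Finite L}
    (hw : w.1.natDegree = n) {s : MilnorRing ℓ L[X]} (hs : s ∈ lowSpan ℓ L n) :
    sym ℓ w.1 * s ∈ lowSpan ℓ L n := by
  have hc : sym ℓ (-1 : L[X]) ∈ low ℓ L n := sym_mem_low (lt_of_eq_of_lt (by simp) hn)
  induction hs using AddSubgroup.closure_induction with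
  | mem x h =>
    rcases h with h | ⟨v, hv, z, hz, rfl⟩
    · exact sym_mul_mem_lowSpan hw h
    · rw [← mul_assoc]
      by_cases hwv : w.1 = v.1
      · rw [hwv, sym_mul_self v.2.2.ne_zero, neg_mul, mul_assoc]
        exact neg_mem (sym_mul_mem_lowSpan hv (mul_mem hc hz))
      · have hf : w.1 - v.1 ≠ 0 := sub_ne_zero.2 hwv
        have hfd : (w.1 - v.1).natDegree < n := by
          rw [← hw]
          refine natDegree_lt_natDegree hf (degree_sub_lt_left ?_ w.2.2.ne_zero ?_)
          · rw [degree_eq_natDegree w.2.2.ne_zero, degree_eq_natDegree v.2.2.ne_zero, hw, hv]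
          · rw [w.2.1.leadingCoeff, v.2.1.leadingCoeff]
        have st := steinberg (ℓ := ℓ) v.2.2.ne_zero hf w.2.2.ne_zero (add_sub_cancel _ _)
        have hfm := sym_mem_low (ℓ := ℓ) hfd
        generalize w.1 - v.1 = f at *
        have sw := sym_mul_self (ℓ := ℓ) w.2.2.ne_zero
        have e : sym ℓ w.1 * sym ℓ v.1 * z = sym ℓ w.1 * (sym ℓ f * z) +
            sym ℓ w.1 * (sym ℓ (-1) * z) - sym ℓ v.1 * (sym ℓ f * z) := by
          rw [sym_mul_sym_comm w.1 v.1]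
          have : (sym ℓ v.1 - sym ℓ w.1) * (sym ℓ f - sym ℓ w.1) = sym ℓ v.1 * sym ℓ f -
            sym ℓ v.1 * sym ℓ w.1 - sym ℓ w.1 * sym ℓ f + sym ℓ w.1 * sym ℓ w.1 := by
            noncomm_ring
          rw [this, sw] at st
          have st' : sym ℓ v.1 * sym ℓ w.1 = sym ℓ v.1 * sym ℓ f - sym ℓ w.1 * sym ℓ f +
              -(sym ℓ w.1 * sym ℓ (-1)) := by
            rw [← sub_eq_zero, ← neg_eq_zero, ← st]
            noncomm_ring
          rw [st']
          noncomm_ring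
        rw [e]
        exact sub_mem (add_mem (sym_mul_mem_lowSpan hw (mul_mem hfm hz))
          (sym_mul_mem_lowSpan hw (mul_mem hc hz))) (sym_mul_mem_lowSpan hv (mul_mem hfm hz))
  | zero => simp
  | add x y _ _ hx hy => rw [mul_add]; exact add_mem hx hy
  | neg x _ hx => rw [mul_neg]; exact neg_mem hx

theorem sym_mul_mem_lowSpan_of_le {n : ℕ} (hn : 1 ≤ n) {g : L[X]} (hg0 : g ≠ 0)
    (hg : g.natDegree ≤ n) {s : MilnorRing ℓ L[X]} (hs : s ∈ lowSpan ℓ L n) :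
    sym ℓ g * s ∈ lowSpan ℓ L n := by
  rcases hg.lt_or_eq with hlt | heq
  · exact sym_mul_mem_lowSpan_of_lt hlt hs
  by_cases hirr : Irreducible g
  · have hlc := leadingCoeff_ne_zero.2 hg0
    have hlc' : (C g.leadingCoeff⁻¹ : L[X]) ≠ 0 := C_ne_zero.2 (inv_ne_zero hlc)
    have hm : (g * C g.leadingCoeff⁻¹).Monic := monic_mul_leadingCoeff_inv hg0
    have hi : Irreducible (g * C g.leadingCoeff⁻¹) :=
      (irreducible_mul_isUnit (isUnit_C.2 (inv_ne_zero hlc).isUnit)).2 hirr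
    have hd : (g * C g.leadingCoeff⁻¹).natDegree = n := by
      rw [natDegree_mul_C (inv_ne_zero hlc), heq]
    have h1 := sym_mul_mem_lowSpan_of_irreducible (w := ⟨_, hm, hi⟩) hn hd hs
    have h2 := sym_mul_mem_lowSpan_of_lt (g := C g.leadingCoeff⁻¹) (lt_of_eq_of_lt (by simp) hn) hs
    rw [sym_mul hg0 hlc', add_mul] at h1
    exact (AddSubgroup.add_mem_cancel_right _ h2).1 h1
  · have hu : ¬ IsUnit g := fun h => by
      rw [natDegree_eq_zero_of_isUnit h] at heq
      omega
    rw [irreducible_iff] at hirr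
    push Not at hirr
    obtain ⟨p, q, hpq, hp, hq⟩ := hirr hu
    have hp0 : p ≠ 0 := fun h => hg0 (by rw [hpq, h, zero_mul])
    have hq0 : q ≠ 0 := fun h => hg0 (by rw [hpq, h, mul_zero])
    have hdp := natDegree_pos_iff_degree_pos.2 (degree_pos_of_ne_zero_of_nonunit hp0 hp)
    have hdq := natDegree_pos_iff_degree_pos.2 (degree_pos_of_ne_zero_of_nonunit hq0 hq)
    rw [hpq, natDegree_mul hp0 hq0] at heq
    rw [hpq, sym_mul hp0 hq0, add_mul]
    exact add_mem (sym_mul_mem_lowSpan_of_lt (by omega) hs)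
      (sym_mul_mem_lowSpan_of_lt (by omega) hs)

theorem low_succ_le_lowSpan {n : ℕ} (hn : 1 ≤ n) {z : MilnorRing ℓ L[X]}
    (hz : z ∈ low ℓ L (n + 1)) : z ∈ lowSpan ℓ L n := by
  have : ∀ s ∈ lowSpan ℓ L n, z * s ∈ lowSpan ℓ L n := by
    refine low_induction (p := fun z => ∀ s ∈ lowSpan ℓ L n, z * s ∈ lowSpan ℓ L n)
      ?_ ?_ ?_ ?_ ?_ ?_ hz
    · simp
    · simp
    · intro g hg hgn s hs
      exact sym_mul_mem_lowSpan_of_le hn hg (by omega) hs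
    · intro x hx s hs
      rw [neg_mul]
      exact neg_mem (hx s hs)
    · intro x y hx hy s hs
      rw [add_mul]
      exact add_mem (hx s hs) (hy s hs)
    · intro x y hx hy s hs
      rw [mul_assoc]
      exact hx _ (hy s hs)
  simpa using this 1 (mem_lowSpan_of_mem_low (one_mem _))

theorem finiteSum_eq_zero_of_forall
    {N : ∀ v : Place.Finite L, MilnorRing ℓ (AdjoinRoot v.1) →+ MilnorRing ℓ L}
    {z : MilnorRing ℓ L[X]} (h : ∀ v, N v (tame ℓ (ofIrreducible v) z) = 0) :
    finiteSum N z = 0 :=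
  (finsum_congr h).trans finsum_zero

theorem tame_infty_eq_zero_of_mem_low {z : MilnorRing ℓ L[X]} (hz : z ∈ low ℓ L 1) :
    tame ℓ (infty L) z = 0 := by
  refine low_induction (p := fun z => tame ℓ (infty L) z = 0) ?_ ?_ ?_ ?_ ?_ ?_ hz
  · exact map_zero _
  · exact tame_one _
  · intro g hg h
    rw [tame_sym _ hg]
    have : (infty L).ord g = 0 := by
      change -(g.natDegree : ℤ) = 0
      omega
    rw [this, Int.cast_zero]
  · intro x hx
    rw [map_neg, hx, neg_zero]
  · intro x y hx hy
    rw [map_add, hx, hy, add_zero]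
  · intro x y hx hy
    exact tame_mul_of_tame_eq_zero _ hx hy

/-- The reciprocity law for the rational function field, in bounded degree. -/
theorem exists_reciprocity (ℓ : ℕ) (L : Type*) [Field L] (n : ℕ) :
    ∃ N : ∀ v : Place.Finite L, MilnorRing ℓ (AdjoinRoot v.1) →+ MilnorRing ℓ L,
      ∀ z ∈ low ℓ L (n + 1), tame ℓ (infty L) z + finiteSum N z = 0 := by
  classical
  induction n with
  | zero =>
    refine ⟨fun _ => 0, fun z hz => ?_⟩
    rw [tame_infty_eq_zero_of_mem_low hz, zero_add]
    exact finiteSum_eq_zero_of_forall fun v => rfl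
  | succ n ih =>
    obtain ⟨N, hN⟩ := ih
    let N0 : ∀ v : Place.Finite L, MilnorRing ℓ (AdjoinRoot v.1) →+ MilnorRing ℓ L :=
      fun v => if v.1.natDegree < n + 1 then N v else 0
    let f : MilnorRing ℓ L[X] →+ MilnorRing ℓ L := tame ℓ (infty L) + finiteSum N0
    have hf : ∀ z ∈ low ℓ L (n + 1), f z = 0 := by
      intro z hz
      rw [← hN z hz]
      change _ + finiteSum N0 z = _
      congr 1
      refine finsum_congr fun v => ?_
      by_cases h : v.1.natDegree < n + 1
      · rw [show N0 v = N v from if_pos h]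
      · rw [tame_eq_zero_of_mem_low (not_lt.1 h) hz, map_zero, map_zero]
    have hex : ∀ v : Place.Finite L, ∃ M : MilnorRing ℓ (AdjoinRoot v.1) →+ MilnorRing ℓ L,
        (v.1.natDegree = n + 1 → ∀ z ∈ low ℓ L (n + 1),
          M (spec ℓ (ofIrreducible v) z) = - f (sym ℓ v.1 * z)) ∧
        (v.1.natDegree ≠ n + 1 → M = 0) := by
      intro v
      by_cases h : v.1.natDegree = n + 1
      · obtain ⟨M, hM⟩ := exists_residue_factor v f (by rw [h]; exact hf)
        refine ⟨-M, fun _ z hz => ?_, fun h' => absurd h h'⟩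
        rw [← hM z (by rwa [h])]
        rfl
      · exact ⟨0, fun h' => absurd h' h, fun _ => rfl⟩
    choose M hM1 hM2 using hex
    refine ⟨fun v => N0 v + M v, fun z hz => ?_⟩
    rw [finiteSum_add, ← add_assoc]
    change f z + finiteSum M z = 0
    have hz' := low_succ_le_lowSpan (Nat.le_add_left 1 n) hz
    clear hz
    induction hz' using AddSubgroup.closure_induction with
    | mem x h =>
      rcases h with h | ⟨v, hv, z, hz, rfl⟩
      · rw [hf x h, zero_add]
        refine finiteSum_eq_zero_of_forall fun v => ?_
        by_cases hv : v.1.natDegree = n + 1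
        · rw [tame_eq_zero_of_mem_low hv.ge h, map_zero]
        · rw [hM2 v hv]
          rfl
      · have : finiteSum M (sym ℓ v.1 * z) = M v (tame ℓ (ofIrreducible v) (sym ℓ v.1 * z)) := by
          refine finsum_eq_single _ v fun w hw => ?_
          by_cases hwd : w.1.natDegree = n + 1
          · rw [tame_sym_mul _ v.2.2.ne_zero, (ofIrreducible_of_not_dvd w (not_dvd_of_ne hw)).1,
              tame_eq_zero_of_mem_low hwd.ge hz, zero_zsmul, mul_zero, add_zero, map_zero]
          · rw [hM2 w hwd]
            rfl
        rw [this, tame_sym_mul _ v.2.2.ne_zero, tame_eq_zero_of_mem_low hv.ge hz, mul_zero,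
          add_zero, (ofIrreducible_self v).1, one_zsmul, hM1 v hv z hz, add_neg_cancel]
    | zero => simp
    | add x y _ _ hx hy =>
      rw [map_add, map_add, add_add_add_comm, hx, hy, add_zero]
    | neg x _ hx =>
      rw [map_neg, map_neg, ← neg_add, hx, neg_zero]

end MilnorRing

namespace MilnorRing

open Polynomial Place

variable {ℓ : ℕ}

/-- The restriction map of a field extension. -/
def res (ℓ : ℕ) (L M : Type*) [Field L] [Field M] [Algebra L M] :
    MilnorRing ℓ L →+* MilnorRing ℓ M :=
  map ℓ (algebraMap L M) (algebraMap L M).injective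

theorem res_sym {L M : Type*} [Field L] [Field M] [Algebra L M] (a : L) :
    res ℓ L M (sym ℓ a) = sym ℓ (algebraMap L M a) :=
  map_sym _ _ a

theorem res_res (L M E : Type*) [Field L] [Field M] [Field E] [Algebra L M] [Algebra L E]
    [Algebra M E] [IsScalarTower L M E] (x : MilnorRing ℓ L) :
    res ℓ M E (res ℓ L M x) = res ℓ L E x :=
  map_map _ _ _ _ _ _ (fun x => (IsScalarTower.algebraMap_apply L M E x).symm) x

section Reciprocity

variable {L : Type*} [Field L]

/-- Symbols of constants. -/
def const (ℓ : ℕ) (L : Type*) [Field L] : MilnorRing ℓ L →+* MilnorRing ℓ L[X] :=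
  map ℓ C C_injective

theorem const_mem_low {n : ℕ} (hn : 1 ≤ n) (y : MilnorRing ℓ L) : const ℓ L y ∈ low ℓ L n := by
  induction y using MilnorRing.induction with
  | zero => simp
  | one => simp
  | sym a ha =>
    rw [const, map_sym]
    exact sym_mem_low (lt_of_eq_of_lt (natDegree_C a) hn)
  | neg x hx => rw [map_neg]; exact neg_mem hx
  | add x y hx hy => rw [map_add]; exact add_mem hx hy
  | mul x y hx hy => rw [map_mul]; exact mul_mem hx hy

theorem spec_infty_const (y : MilnorRing ℓ L) : spec ℓ (infty L) (const ℓ L y) = y := by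
  have : (spec ℓ (infty L)).comp (const ℓ L) = RingHom.id _ := ringHom_ext fun a ha => by
    rw [RingHom.comp_apply, const, map_sym, spec_sym _ (C_ne_zero.2 ha)]
    exact congrArg _ (leadingCoeff_C a)
  exact DFunLike.congr_fun this y

theorem spec_ofIrreducible_const (v : Place.Finite L) (y : MilnorRing ℓ L) :
    spec ℓ (ofIrreducible v) (const ℓ L y) = res ℓ L (AdjoinRoot v.1) y := by
  have : (spec ℓ (ofIrreducible v)).comp (const ℓ L) = res ℓ L (AdjoinRoot v.1) :=
    ringHom_ext fun a ha => by
      rw [RingHom.comp_apply, const, map_sym, spec_sym _ (C_ne_zero.2 ha), res_sym,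
        (ofIrreducible_of_natDegree_lt v (C_ne_zero.2 ha)
          (lt_of_eq_of_lt (natDegree_C a) v.2.2.natDegree_pos)).2]
      rfl
  exact DFunLike.congr_fun this y

theorem tame_infty_const (y : MilnorRing ℓ L) : tame ℓ (infty L) (const ℓ L y) = 0 :=
  tame_infty_eq_zero_of_mem_low (const_mem_low le_rfl y)

theorem tame_const (v : Place.Finite L) (y : MilnorRing ℓ L) :
    tame ℓ (ofIrreducible v) (const ℓ L y) = 0 :=
  tame_eq_zero_of_mem_low v.2.2.natDegree_pos (const_mem_low le_rfl y)

theorem infty_ord_of_monic (v : Place.Finite L) : (infty L).ord v.1 = -(v.1.natDegree : ℤ) := rfl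

theorem infty_ac_of_monic (v : Place.Finite L) : (infty L).ac v.1 = 1 := v.2.1.leadingCoeff

theorem tame_self_mul (v : Place.Finite L) {z : MilnorRing ℓ L[X]}
    (hz : tame ℓ (ofIrreducible v) z = 0) :
    tame ℓ (ofIrreducible v) (sym ℓ v.1 * z) = spec ℓ (ofIrreducible v) z := by
  rw [tame_sym_mul _ v.2.2.ne_zero, (ofIrreducible_self v).1, one_zsmul, hz, mul_zero, add_zero]

theorem tame_other (v w : Place.Finite L) (h : v ≠ w) :
    tame ℓ (ofIrreducible w) (sym ℓ v.1) = 0 := by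
  rw [tame_sym _ v.2.2.ne_zero, (ofIrreducible_of_not_dvd w (not_dvd_of_ne h.symm)).1,
    Int.cast_zero]

variable {n : ℕ} {N : ∀ v : Place.Finite L, MilnorRing ℓ (AdjoinRoot v.1) →+ MilnorRing ℓ L}

theorem transfer_res
    (hN : ∀ z ∈ low ℓ L (n + 1), tame ℓ (infty L) z + finiteSum N z = 0)
    (v : Place.Finite L) (hv : v.1.natDegree ≤ n) (z : MilnorRing ℓ L) :
    N v (res ℓ L (AdjoinRoot v.1) z) = v.1.natDegree • z := by
  have h := hN (sym ℓ v.1 * const ℓ L z)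
    (mul_mem (sym_mem_low (by omega)) (const_mem_low (by omega) z))
  have h1 : finiteSum N (sym ℓ v.1 * const ℓ L z) =
      N v (tame ℓ (ofIrreducible v) (sym ℓ v.1 * const ℓ L z)) := by
    refine finsum_eq_single _ v fun w hw => ?_
    rw [tame_mul_of_tame_eq_zero _ (tame_other v w hw.symm) (tame_const w z), map_zero]
  rw [h1, tame_self_mul _ (tame_const v z), spec_ofIrreducible_const,
    tame_sym_mul _ v.2.2.ne_zero, tame_infty_const, mul_zero, add_zero, spec_infty_const,
    infty_ord_of_monic, neg_zsmul, natCast_zsmul] at h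
  exact eq_of_sub_eq_zero (by rw [← h]; abel)

/-- The place at the origin. -/
def origin (L : Type*) [Field L] : Place.Finite L := ⟨X, monic_X, irreducible_X⟩

theorem transfer_root_mul
    (hN : ∀ z ∈ low ℓ L (n + 1), tame ℓ (infty L) z + finiteSum N z = 0)
    (v : Place.Finite L) (hv : v.1.natDegree ≤ n) (hvX : v ≠ origin L) (y : MilnorRing ℓ L) :
    N v (sym ℓ (AdjoinRoot.root v.1) * res ℓ L (AdjoinRoot v.1) y) =
      sym ℓ ((-1) ^ v.1.natDegree * v.1.coeff 0) * y := by
  have hpos := v.2.2.natDegree_pos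
  have hX : ∀ w : Place.Finite L, origin L ≠ w →
      tame ℓ (ofIrreducible w) (sym ℓ (X : L[X])) = 0 := tame_other (origin L)
  have hcoeff : v.1.coeff 0 ≠ 0 := fun h => not_dvd_of_ne hvX.symm (X_dvd_iff.2 h)
  have h := hN (sym ℓ v.1 * (sym ℓ X * const ℓ L y))
    (mul_mem (sym_mem_low (by omega)) (mul_mem (sym_mem_low (by rw [natDegree_X]; omega))
      (const_mem_low (by omega) y)))
  have h1 : finiteSum N (sym ℓ v.1 * (sym ℓ X * const ℓ L y)) =
      N v (tame ℓ (ofIrreducible v) (sym ℓ v.1 * (sym ℓ X * const ℓ L y))) +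
      N (origin L) (tame ℓ (ofIrreducible (origin L)) (sym ℓ v.1 * (sym ℓ X * const ℓ L y))) := by
    classical
    have : finiteSum N (sym ℓ v.1 * (sym ℓ X * const ℓ L y)) =
        ∑ w ∈ {v, origin L}, N w (tame ℓ (ofIrreducible w)
          (sym ℓ v.1 * (sym ℓ X * const ℓ L y))) := by
      refine finsum_eq_finsetSum_of_support_subset _ fun w hw => ?_
      by_contra hne
      simp only [Finset.coe_insert, Finset.coe_singleton, Set.mem_insert_iff,
        Set.mem_singleton_iff, not_or] at hne
      refine hw ?_
      change N w _ = 0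
      rw [tame_mul_of_tame_eq_zero _ (tame_other v w (Ne.symm hne.1))
        (tame_mul_of_tame_eq_zero _ (hX w (Ne.symm hne.2)) (tame_const w y)),
        map_zero]
    rw [this, Finset.sum_pair hvX]
  have h2 : tame ℓ (ofIrreducible v) (sym ℓ v.1 * (sym ℓ X * const ℓ L y)) =
      sym ℓ (AdjoinRoot.root v.1) * res ℓ L (AdjoinRoot v.1) y := by
    rw [tame_self_mul _ (tame_mul_of_tame_eq_zero _ (hX v hvX.symm)
      (tame_const v y)), map_mul, spec_ofIrreducible_const, spec_sym _ X_ne_zero,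
      (ofIrreducible_of_not_dvd v (f := X) (not_dvd_of_ne (w := origin L) hvX)).2,
      AdjoinRoot.mk_X]
  have h3 : tame ℓ (ofIrreducible (origin L)) (sym ℓ v.1 * (sym ℓ X * const ℓ L y)) =
      -res ℓ L (AdjoinRoot (origin L).1) (sym ℓ (v.1.coeff 0) * y) := by
    have e := ofIrreducible_of_not_dvd (origin L) (not_dvd_of_ne (w := v) hvX.symm)
    have e2 : AdjoinRoot.mk (origin L).1 v.1 =
        algebraMap L (AdjoinRoot (origin L).1) (v.1.coeff 0) := by
      change _ = AdjoinRoot.mk (origin L).1 (C _)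
      rw [AdjoinRoot.mk_eq_mk]
      exact X_dvd_sub_C
    rw [tame_sym_mul _ v.2.2.ne_zero, e.1, e.2, zero_zsmul, zero_zsmul, zero_add, add_zero, e2]
    have := tame_self_mul (ℓ := ℓ) (origin L) (tame_const (origin L) y)
    change tame ℓ (ofIrreducible (origin L)) (sym ℓ X * _) = _ at this
    rw [this, spec_ofIrreducible_const, map_mul, res_sym, neg_mul]
  have h4 : tame ℓ (infty L) (sym ℓ v.1 * (sym ℓ X * const ℓ L y)) =
      v.1.natDegree • (sym ℓ (-1) * y) := by
    rw [tame_sym_mul _ v.2.2.ne_zero, tame_sym_mul _ X_ne_zero, tame_infty_const, map_mul,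
      spec_sym _ X_ne_zero, spec_infty_const, infty_ord_of_monic, infty_ac_of_monic]
    have e1 : (infty L).ac X = 1 := leadingCoeff_X
    have e2 : (infty L).ord X = -1 := by
      change -((X : L[X]).natDegree : ℤ) = -1
      rw [natDegree_X]
      rfl
    rw [e1, e2, sym_one]
    simp [mul_assoc]
  have h5 := transfer_res hN (origin L) (by change (X : L[X]).natDegree ≤ n; rw [natDegree_X]; omega)
    (sym ℓ (v.1.coeff 0) * y)
  change _ = (X : L[X]).natDegree • _ at h5
  rw [natDegree_X, one_smul] at h5
  rw [h1, h2, h3, h4, map_neg, h5] at h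
  rw [sym_mul (pow_ne_zero _ (neg_ne_zero.2 one_ne_zero)) hcoeff,
    sym_pow (neg_ne_zero.2 one_ne_zero), add_mul, smul_mul_assoc]
  have h6 : v.1.natDegree • (sym ℓ (-1) * y) + v.1.natDegree • (sym ℓ (-1) * y) = 0 := by
    rw [← smul_add, ← add_mul, sym_neg_one_add_self, zero_mul, smul_zero]
  generalize v.1.natDegree • (sym ℓ (-1) * y) = a at *
  rw [eq_neg_of_add_eq_zero_right h6] at h
  rw [← sub_eq_zero, ← h]
  abel

end Reciprocity

section Simple

variable {L M : Type*} [Field L] [Field M] [Algebra L M]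

/-- The place attached to a generator of a simple extension. -/
def placeOfGen (pb : PowerBasis L M) : Place.Finite L :=
  ⟨minpoly L pb.gen, minpoly.monic pb.isIntegral_gen, minpoly.irreducible pb.isIntegral_gen⟩

/-- The comparison of a simple extension with the residue field of its place. -/
def toAdjoinRoot (pb : PowerBasis L M) : M →ₐ[L] AdjoinRoot (placeOfGen pb).1 :=
  pb.lift (AdjoinRoot.root _) (by
    rw [AdjoinRoot.aeval_eq]
    exact AdjoinRoot.mk_self)

theorem map_toAdjoinRoot_res (pb : PowerBasis L M) (y : MilnorRing ℓ L) :
    map ℓ (toAdjoinRoot pb).toRingHom (toAdjoinRoot pb).toRingHom.injective (res ℓ L M y) =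
      res ℓ L (AdjoinRoot (placeOfGen pb).1) y :=
  map_map _ _ _ _ _ _ (fun x => (toAdjoinRoot pb).commutes x) y

theorem dim_smul_eq_zero (pb : PowerBasis L M) {y : MilnorRing ℓ L} (h : res ℓ L M y = 0) :
    pb.dim • y = 0 := by
  obtain ⟨N, hN⟩ := exists_reciprocity ℓ L (placeOfGen pb).1.natDegree
  have h1 := transfer_res hN (placeOfGen pb) le_rfl y
  rw [← map_toAdjoinRoot_res, h, map_zero, map_zero] at h1
  rw [← pb.natDegree_minpoly]
  exact h1.symm

theorem smul_sym_norm_mul_eq_zero (pb : PowerBasis L M) (hb : pb.gen ≠ 0) {y : MilnorRing ℓ L}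
    (m : ℕ) (h : m • (sym ℓ pb.gen * res ℓ L M y) = 0) :
    m • (sym ℓ (Algebra.norm L pb.gen) * y) = 0 := by
  obtain ⟨N, hN⟩ := exists_reciprocity ℓ L (placeOfGen pb).1.natDegree
  have hne : placeOfGen pb ≠ origin L := fun he => hb (by
    have h1 : minpoly L pb.gen = X := congrArg Subtype.val he
    have h2 := minpoly.aeval L pb.gen
    rwa [h1, aeval_X] at h2)
  have h1 := transfer_root_mul hN (placeOfGen pb) le_rfl hne y
  have h2 := congrArg (map ℓ (toAdjoinRoot pb).toRingHom (toAdjoinRoot pb).toRingHom.injective) h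
  rw [map_nsmul, map_mul, map_toAdjoinRoot_res, map_sym, map_zero] at h2
  change m • (sym ℓ (toAdjoinRoot pb pb.gen) * _) = 0 at h2
  rw [toAdjoinRoot, PowerBasis.lift_gen] at h2
  have h3 := congrArg (N (placeOfGen pb)) h2
  rw [map_nsmul, h1, map_zero] at h3
  rw [Algebra.PowerBasis.norm_gen_eq_coeff_zero_minpoly, ← pb.natDegree_minpoly]
  exact h3

theorem sym_norm_mul_eq_zero [FiniteDimensional L M] {e : M}
    (he : IntermediateField.adjoin L {e} = ⊤) {β : M} (hβ : β ≠ 0) {y : MilnorRing ℓ L}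
    (h : sym ℓ β * res ℓ L M y = 0) : sym ℓ (Algebra.norm L β) * y = 0 := by
  let E := IntermediateField.adjoin L {β}
  have hinteg : ∀ x : M, IsIntegral L x := fun x => Algebra.IsIntegral.isIntegral x
  let pb : PowerBasis L E := IntermediateField.adjoin.powerBasis (hinteg β)
  have hgen : algebraMap E M pb.gen = β := by
    change algebraMap E M (IntermediateField.adjoin.powerBasis (hinteg β)).gen = β
    rw [IntermediateField.adjoin.powerBasis_gen]
    rfl
  have htop : Algebra.adjoin E {e} = ⊤ := by
    rw [← top_le_iff]
    intro x _
    have hx : x ∈ Algebra.adjoin L {e} := by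
      have : x ∈ IntermediateField.adjoin L {e} := he ▸ IntermediateField.mem_top
      rwa [← IntermediateField.mem_toSubalgebra,
        IntermediateField.adjoin_simple_toSubalgebra_of_isAlgebraic (hinteg e).isAlgebraic] at this
    have hle : Algebra.adjoin L {e} ≤ (Algebra.adjoin E {e}).restrictScalars L :=
      Algebra.adjoin_le Algebra.subset_adjoin
    exact hle hx
  let pb' : PowerBasis E M := PowerBasis.ofAdjoinEqTop (hinteg e).tower_top htop
  have h1 : pb'.dim • (sym ℓ pb.gen * res ℓ L E y) = 0 := by
    refine dim_smul_eq_zero pb' ?_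
    rw [map_mul, res_sym, hgen, res_res, h]
  have h2 := smul_sym_norm_mul_eq_zero pb (fun h0 => hβ (by rw [← hgen, h0, map_zero])) _ h1
  have hN0 : Algebra.norm L pb.gen ≠ 0 :=
    Algebra.norm_ne_zero_iff.2 fun h0 => hβ (by rw [← hgen, h0, map_zero])
  have h3 : Algebra.norm L β = Algebra.norm L pb.gen ^ pb'.dim := by
    rw [← hgen, ← Algebra.norm_norm (S := E), Algebra.norm_algebraMap, map_pow, pb'.finrank]
  rw [h3, sym_pow hN0, smul_mul_assoc, h2]

end Simple

end MilnorRing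

namespace Tsen

open MvPolynomial

theorem exists_common_zero {C τ ι : Type*} [Field C] [IsAlgClosed C] [Finite τ] [Finite ι]
    (h : Nat.card ι < Nat.card τ) (f : ι → MvPolynomial τ C)
    (hf : ∀ i, constantCoeff (f i) = 0) : ∃ x : τ → C, x ≠ 0 ∧ ∀ i, aeval x (f i) = 0 := by
  by_contra! hcon
  have hzero : ∀ i, aeval (0 : τ → C) (f i) = 0 := fun i => by
    rw [aeval_zero, hf, map_zero]
  have hloc : zeroLocus C (Ideal.span (Set.range f)) = {0} := by
    rw [zeroLocus_span]
    ext x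
    constructor
    · intro hx
      by_contra hx0
      obtain ⟨i, hi⟩ := hcon x hx0
      exact hi (hx _ ⟨i, rfl⟩)
    · rintro rfl p ⟨i, rfl⟩
      exact hzero i
  have hmin : vanishingIdeal C {(0 : τ → C)} ∈ (Ideal.span (Set.range f)).minimalPrimes := by
    rw [← Ideal.radical_minimalPrimes, ← vanishingIdeal_zeroLocus_eq_radical (K := C), hloc,
      Ideal.minimalPrimes_eq_subsingleton_self]
    rfl
  have hh : (vanishingIdeal C {(0 : τ → C)}).height ≤ (Nat.card ι : ℕ∞) := by
    refine (Ideal.height_le_card_of_mem_minimalPrimes_span (Set.finite_range f) hmin).trans ?_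
    exact_mod_cast Finite.card_range_le f
  have hdim : ringKrullDim (MvPolynomial τ C) ≤ (Nat.card ι : ℕ∞) := by
    rw [ringKrullDim_le_iff_isMaximal_height_le]
    intro m hm
    obtain ⟨x, rfl⟩ := eq_vanishingIdeal_singleton_of_isMaximal C hm
    let e : MvPolynomial τ C ≃ₐ[C] MvPolynomial τ C :=
      AlgEquiv.ofAlgHom (aeval fun i => X i - MvPolynomial.C (x i))
        (aeval fun i => X i + MvPolynomial.C (x i))
        (by ext i : 1; simp [algebraMap_eq]) (by ext i : 1; simp [algebraMap_eq])
    have : vanishingIdeal C {x} = (vanishingIdeal C {(0 : τ → C)}).comap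
        (aeval fun i => X i + MvPolynomial.C (x i) : MvPolynomial τ C →ₐ[C] MvPolynomial τ C) := by
      ext p
      rw [Ideal.mem_comap, mem_vanishingIdeal_singleton_iff, mem_vanishingIdeal_singleton_iff]
      have : (aeval (0 : τ → C)).comp (aeval fun i => X i + MvPolynomial.C (x i) :
          MvPolynomial τ C →ₐ[C] MvPolynomial τ C) = aeval x := by
        ext i; simp
      exact iff_of_eq (congrArg (· = 0) (DFunLike.congr_fun this p).symm)
    have h2 := RingEquiv.height_comap e.symm.toRingEquiv (vanishingIdeal C {(0 : τ → C)})
    have h3 : (vanishingIdeal C {x}).height = (vanishingIdeal C {(0 : τ → C)}).height := by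
      rw [← h2, this]; rfl
    rw [h3]
    exact_mod_cast hh
  rw [MvPolynomial.ringKrullDim_of_isNoetherianRing, ringKrullDim_eq_zero_of_field, zero_add] at hdim
  have : (Nat.card τ : ℕ∞) ≤ Nat.card ι := by exact_mod_cast hdim
  exact absurd (by exact_mod_cast this) (not_le.2 h)

end Tsen

namespace Tsen

open Polynomial

section Bounded

variable {C τ J Λ : Type*} [Field C] [CommRing Λ] [Algebra C[X] Λ]

/-- The algebra of polynomial functions on an affine space. -/
def polyFun (C τ : Type*) [Field C] : Subalgebra C ((τ → C) → C) :=
  (MvPolynomial.aeval (R := C) fun (i : τ) (T : τ → C) => T i).range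

theorem const_mem_polyFun (c : C) : (fun _ : τ → C => c) ∈ polyFun C τ :=
  (polyFun C τ).algebraMap_mem c

theorem coord_mem_polyFun (i : τ) : (fun T : τ → C => T i) ∈ polyFun C τ :=
  ⟨MvPolynomial.X i, by simp⟩

theorem exists_of_mem_polyFun {f : (τ → C) → C} (hf : f ∈ polyFun C τ) :
    ∃ P : MvPolynomial τ C, ∀ T, MvPolynomial.aeval T P = f T := by
  obtain ⟨P, rfl⟩ := hf
  refine ⟨P, fun T => ?_⟩
  have : (Pi.evalAlgHom C (fun _ : τ → C => C) T).comp
      (MvPolynomial.aeval (R := C) fun (i : τ) (T : τ → C) => T i) = MvPolynomial.aeval T := by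
    ext i; simp
  exact (DFunLike.congr_fun this P).symm

/-- Functions whose coordinates are polynomials of bounded degree with coefficients depending
polynomially on the argument. -/
structure Bounded (w : Module.Basis J C[X] Λ) (D : ℕ) (F : (τ → C) → Λ) : Prop where
  coeff_mem : ∀ j s, (fun T => (w.repr (F T) j).coeff s) ∈ polyFun C τ
  natDegree_le : ∀ T j, (w.repr (F T) j).natDegree ≤ D

variable {w : Module.Basis J C[X] Λ}

theorem Bounded.mono {D D' : ℕ} (h : D ≤ D') {F : (τ → C) → Λ} (hF : Bounded w D F) :
    Bounded w D' F :=
  ⟨hF.1, fun T j => (hF.2 T j).trans h⟩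

theorem Bounded.congr {D : ℕ} {F G : (τ → C) → Λ} (hF : Bounded w D F) (h : ∀ T, F T = G T) :
    Bounded w D G :=
  (funext h : F = G) ▸ hF

theorem bounded_const {D : ℕ} {a : Λ} (ha : ∀ j, (w.repr a j).natDegree ≤ D) :
    Bounded w D (fun _ : τ → C => a) :=
  ⟨fun _ _ => const_mem_polyFun _, fun _ => ha⟩

theorem Bounded.add {D : ℕ} {F G : (τ → C) → Λ} (hF : Bounded w D F) (hG : Bounded w D G) :
    Bounded w D (fun T => F T + G T) := by
  refine ⟨fun j s => ?_, fun T j => ?_⟩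
  · simp only [map_add, Finsupp.add_apply, coeff_add]
    exact add_mem (hF.1 j s) (hG.1 j s)
  · rw [map_add, Finsupp.add_apply]
    exact natDegree_add_le_of_degree_le (hF.2 T j) (hG.2 T j)

theorem Bounded.sum {D : ℕ} {ι : Type*} (s : Finset ι) {F : ι → (τ → C) → Λ}
    (hF : ∀ i ∈ s, Bounded w D (F i)) : Bounded w D (fun T => ∑ i ∈ s, F i T) := by
  classical
  induction s using Finset.induction_on with
  | empty => exact ⟨fun j s => by simpa using const_mem_polyFun (C := C) (τ := τ) 0, fun T j => by simp⟩
  | insert a s ha ih =>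
    simp only [Finset.sum_insert ha]
    exact (hF a (Finset.mem_insert_self a s)).add
      (ih fun i hi => hF i (Finset.mem_insert_of_mem hi))

theorem Bounded.mul [Fintype J] {c D D' : ℕ}
    (hc : ∀ p : J × J × J, (w.repr (w p.1 * w p.2.1) p.2.2).natDegree ≤ c)
    {F G : (τ → C) → Λ} (hF : Bounded w D F) (hG : Bounded w D' G) :
    Bounded w (D + D' + c) (fun T => F T * G T) := by
  have key : ∀ T j, w.repr (F T * G T) j =
      ∑ a, ∑ b, w.repr (F T) a * w.repr (G T) b * w.repr (w a * w b) j := by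
    intro T j
    conv_lhs => rw [← w.sum_repr (F T), ← w.sum_repr (G T)]
    simp only [Finset.sum_mul_sum, smul_mul_smul_comm, map_sum, map_smul, Finsupp.coe_finsetSum,
      Finset.sum_apply, Finsupp.smul_apply, smul_eq_mul]
  refine ⟨fun j s => ?_, fun T j => ?_⟩
  · have : (fun T => (w.repr (F T * G T) j).coeff s) = ∑ a, ∑ b,
        ∑ p ∈ Finset.HasAntidiagonal.antidiagonal s, (∑ q ∈ Finset.HasAntidiagonal.antidiagonal p.1,
          (fun T => (w.repr (F T) a).coeff q.1) * (fun T => (w.repr (G T) b).coeff q.2)) *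
          (fun _ => (w.repr (w a * w b) j).coeff p.2) := by
      ext T
      simp only [key, finsetSum_coeff, coeff_mul, Finset.sum_apply, Pi.mul_apply]
    rw [this]
    exact sum_mem fun a _ => sum_mem fun b _ => sum_mem fun p _ => mul_mem
      (sum_mem fun q _ => mul_mem (hF.1 _ _) (hG.1 _ _)) (const_mem_polyFun _)
  · rw [key]
    exact natDegree_sum_le_of_forall_le _ _ fun a _ => natDegree_sum_le_of_forall_le _ _ fun b _ =>
      natDegree_mul_le_of_le (natDegree_mul_le_of_le (hF.2 T a) (hG.2 T b)) (hc (a, b, j))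

theorem Bounded.mul_pow [Fintype J] {c D D' : ℕ}
    (hc : ∀ p : J × J × J, (w.repr (w p.1 * w p.2.1) p.2.2).natDegree ≤ c)
    {F G : (τ → C) → Λ} (hF : Bounded w D F) (hG : Bounded w D' G) (n : ℕ) :
    Bounded w (D + n * (D' + c)) (fun T => F T * G T ^ n) := by
  induction n with
  | zero => simpa using hF
  | succ n ih =>
    simp only [pow_succ, ← mul_assoc]
    exact (ih.mul hc hG).mono (by linarith)

theorem Bounded.mul_prod [Fintype J] {c D D' : ℕ} {σ : Type*}
    (hc : ∀ p : J × J × J, (w.repr (w p.1 * w p.2.1) p.2.2).natDegree ≤ c)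
    {F : (τ → C) → Λ} {G : σ → (τ → C) → Λ} (hF : Bounded w D F)
    (hG : ∀ i, Bounded w D' (G i)) (d : σ →₀ ℕ) :
    Bounded w (D + d.degree * (D' + c)) (fun T => F T * d.prod fun i n => G i T ^ n) := by
  induction d using Finsupp.induction_linear generalizing D F with
  | zero => simpa using hF
  | add f g hf hg =>
    have h := hg (hf hF)
    refine (h.mono (le_of_eq ?_)).congr fun T => ?_
    · rw [map_add]; ring
    · rw [Finsupp.prod_add_index' (fun _ => pow_zero _) (fun _ _ _ => pow_add _ _ _), mul_assoc]
  | single i n =>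
    have h := hF.mul_pow hc (hG i) n
    simpa using h

end Bounded

theorem degree_le_totalDegree {Λ σ : Type*} [CommRing Λ] {Φ : MvPolynomial σ Λ} {d : σ →₀ ℕ}
    (hd : d ∈ Φ.support) : d.degree ≤ Φ.totalDegree := by
  rw [Finsupp.degree_apply]
  exact MvPolynomial.le_totalDegree hd

theorem exists_zero_of_free {C Λ σ : Type*} [Field C] [IsAlgClosed C] [CommRing Λ] [Nontrivial Λ]
    [Algebra C[X] Λ] [Module.Free C[X] Λ] [Module.Finite C[X] Λ] [Finite σ]
    (Φ : MvPolynomial σ Λ) (h : Φ.totalDegree < Nat.card σ)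
    (h0 : MvPolynomial.constantCoeff Φ = 0) :
    ∃ x : σ → Λ, x ≠ 0 ∧ MvPolynomial.eval x Φ = 0 := by
  classical
  cases nonempty_fintype σ
  obtain ⟨J, _, w, hJ⟩ : ∃ (J : Type _) (_ : Fintype J) (_ : Module.Basis J C[X] Λ), Nonempty J :=
    ⟨Module.Free.ChooseBasisIndex C[X] Λ, inferInstance, Module.Free.chooseBasis C[X] Λ,
      (Module.Free.chooseBasis C[X] Λ).index_nonempty⟩
  set m := Φ.totalDegree with hm
  obtain ⟨c₁, hcd⟩ : ∃ c, ∀ d ∈ Φ.support, ∀ j, (w.repr (Φ.coeff d) j).natDegree ≤ c := by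
    obtain ⟨c, hc⟩ := Finite.exists_le fun p : Φ.support × J =>
      (w.repr (Φ.coeff p.1) p.2).natDegree
    exact ⟨c, fun d hd j => hc (⟨d, hd⟩, j)⟩
  obtain ⟨c₀, hc₀⟩ : ∃ c, ∀ p : J × J × J, (w.repr (w p.1 * w p.2.1) p.2.2).natDegree ≤ c :=
    Finite.exists_le _
  set N := m * c₀ + c₁ + 1 with hN
  set D := c₁ + m * (N + c₀) with hD
  let pol : σ → (σ × J × Fin (N + 1) → C) → J → C[X] := fun i T j =>
    ∑ s : Fin (N + 1), Polynomial.monomial (s : ℕ) (T (i, j, s))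
  have hpol : ∀ i T j (s : Fin (N + 1)), (pol i T j).coeff s = T (i, j, s) := by
    intro i T j s
    simp only [pol, finsetSum_coeff, coeff_monomial]
    rw [Finset.sum_eq_single s (fun b _ hb => if_neg fun h => hb (Fin.ext h))
      (fun h => absurd (Finset.mem_univ _) h), if_pos rfl]
  let x : σ → (σ × J × Fin (N + 1) → C) → Λ := fun i T => ∑ j, pol i T j • w j
  have hx : ∀ i T j, w.repr (x i T) j = pol i T j := fun i T j => by
    simp only [x, w.repr_sum_self]
  have hxB : ∀ i, Bounded w N (x i) := fun i => by
    refine ⟨fun j s => ?_, fun T j => ?_⟩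
    · simp only [hx, pol, finsetSum_coeff, coeff_monomial]
      have : (fun T : σ × J × Fin (N + 1) → C => ∑ r : Fin (N + 1),
          if (r : ℕ) = s then T (i, j, r) else 0) = ∑ r : Fin (N + 1), if (r : ℕ) = s then
            (fun T : σ × J × Fin (N + 1) → C => T (i, j, r)) else 0 := by
        ext T
        rw [Finset.sum_apply]
        exact Finset.sum_congr rfl fun r _ => by split_ifs <;> rfl
      rw [this]
      refine sum_mem fun r _ => ?_
      split_ifs
      · exact coord_mem_polyFun _
      · exact zero_mem _
    · rw [hx]
      exact natDegree_sum_le_of_forall_le _ _ fun r _ =>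
        (natDegree_monomial_le _).trans (Nat.lt_succ_iff.1 r.2)
  have hB : Bounded w D (fun T => MvPolynomial.eval (fun i => x i T) Φ) := by
    simp only [MvPolynomial.eval_eq']
    refine Bounded.sum _ fun d hd => ?_
    have h1 : Bounded w (c₁ + d.degree * (N + c₀)) fun T =>
        Φ.coeff d * d.prod fun i n => x i T ^ n :=
      Bounded.mul_prod hc₀ (bounded_const (hcd d hd)) hxB d
    have h2 : d.degree ≤ m := degree_le_totalDegree hd
    refine (h1.mono (by rw [hD]; gcongr)).congr fun T => ?_
    rw [Finsupp.prod_fintype _ _ fun _ => pow_zero _]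
  choose P hP using fun (p : J × Fin (D + 1)) => exists_of_mem_polyFun (hB.coeff_mem p.1 p.2)
  have hcard : Nat.card (J × Fin (D + 1)) < Nat.card (σ × J × Fin (N + 1)) := by
    rw [Nat.card_eq_fintype_card] at h
    simp only [Nat.card_eq_fintype_card, Fintype.card_prod, Fintype.card_fin]
    have hJ' : 0 < Fintype.card J := Fintype.card_pos
    have h1 : D + 1 < (m + 1) * (N + 1) := by
      have : (m + 1) * (N + 1) = m * N + N + m + 1 := by ring
      have h3 : D = c₁ + m * N + m * c₀ := by rw [hD]; ring
      omega
    have h2 : (m + 1) * (N + 1) ≤ Fintype.card σ * (N + 1) := Nat.mul_le_mul_right _ h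
    calc Fintype.card J * (D + 1) < Fintype.card J * (Fintype.card σ * (N + 1)) :=
          Nat.mul_lt_mul_of_pos_left (h1.trans_le h2) hJ'
      _ = _ := by ring
  obtain ⟨T, hT, hT0⟩ := exists_common_zero hcard P fun p => by
    have h1 := hP p 0
    have h2 : ∀ i, x i 0 = 0 := fun i => by simp [x, pol]
    rw [MvPolynomial.aeval_zero] at h1
    simp only [h2] at h1
    have h3 : MvPolynomial.eval (fun _ : σ => (0 : Λ)) Φ = 0 := by
      rw [MvPolynomial.eval_zero', h0]
    rw [h3] at h1
    simpa using h1
  refine ⟨fun i => x i T, fun h => hT ?_, ?_⟩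
  · ext ⟨i, j, s⟩
    rw [← hpol i T j s, ← hx, show x i T = 0 from congrFun h i]
    simp
  · apply w.repr.injective
    ext j : 1
    rw [map_zero, Finsupp.zero_apply]
    ext s
    rw [coeff_zero]
    by_cases hs : s ≤ D
    · exact (hP (j, ⟨s, Nat.lt_succ_of_le hs⟩) T).symm.trans (hT0 _)
    · exact coeff_eq_zero_of_natDegree_lt ((hB.2 T j).trans_lt (not_le.1 hs))

end Tsen

namespace Tsen

open Polynomial

theorem exists_zero_of_isAlgebraic {C F σ : Type*} [Field C] [IsAlgClosed C] [Field F]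
    [Algebra C[X] F] [FaithfulSMul C[X] F] [Algebra.IsAlgebraic C[X] F] [Finite σ]
    (Φ : MvPolynomial σ F) (h : Φ.totalDegree < Nat.card σ)
    (h0 : MvPolynomial.constantCoeff Φ = 0) :
    ∃ x : σ → F, x ≠ 0 ∧ MvPolynomial.eval x Φ = 0 := by
  obtain ⟨y, hy0, hy⟩ := Algebra.IsAlgebraic.exists_integral_multiples (R := C[X]) Φ.coeffs
  have hy0' : algebraMap C[X] F y ≠ 0 :=
    (map_ne_zero_iff _ (FaithfulSMul.algebraMap_injective C[X] F)).2 hy0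
  let S : Set F := (fun x => y • x) '' Φ.coeffs
  let Λ := Algebra.adjoin C[X] S
  have : Module.Finite C[X] Λ := .of_fg (fg_adjoin_of_finite (Φ.coeffs.finite_toSet.image _) (by
    rintro _ ⟨x, hx, rfl⟩
    exact hy x hx))
  have hc : ∀ d, (y • Φ).coeff d = y • Φ.coeff d := fun d => MvPolynomial.coeff_smul _ _ _
  have hmem : y • Φ ∈ Set.range (MvPolynomial.map (algebraMap Λ F)) := by
    rw [MvPolynomial.mem_range_map_iff_coeffs_subset]
    intro c hcm
    obtain ⟨d, hd, rfl⟩ := MvPolynomial.mem_coeffs_iff.1 hcm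
    rw [hc]
    refine ⟨⟨y • Φ.coeff d, Algebra.subset_adjoin ⟨_, MvPolynomial.coeff_mem_coeffs d fun h => ?_,
      rfl⟩⟩, rfl⟩
    rw [MvPolynomial.mem_support_iff, hc, h, smul_zero] at hd
    exact hd rfl
  obtain ⟨Ψ, hΨ⟩ := hmem
  have hinj : Function.Injective (algebraMap Λ F) := Subtype.val_injective
  have hcΨ : ∀ d, algebraMap Λ F (Ψ.coeff d) = y • Φ.coeff d := fun d => by
    rw [← hc, ← hΨ, MvPolynomial.coeff_map]
  obtain ⟨x, hx, hx0⟩ := exists_zero_of_free (C := C) Ψ (by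
      refine lt_of_le_of_lt (Finset.sup_mono fun d hd => ?_ : Ψ.totalDegree ≤ Φ.totalDegree) h
      rw [MvPolynomial.mem_support_iff] at hd ⊢
      intro h
      have := hcΨ d
      rw [h, smul_zero, ← map_zero (algebraMap Λ F)] at this
      exact hd (hinj this)) (by
    have := hcΨ 0
    rw [← MvPolynomial.constantCoeff_eq, ← MvPolynomial.constantCoeff_eq, h0, smul_zero,
      ← map_zero (algebraMap Λ F)] at this
    exact hinj this)
  refine ⟨fun i => x i, fun h => hx (funext fun i => Subtype.ext (congrFun h i)), ?_⟩
  have h1 : MvPolynomial.eval (fun i => (x i : F)) (y • Φ) = 0 := by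
    rw [← hΨ, MvPolynomial.eval_map]
    have := MvPolynomial.eval₂_comp_left (algebraMap Λ F) (RingHom.id Λ) x Ψ
    rw [RingHom.comp_id] at this
    exact this.symm.trans ((congrArg _ hx0).trans (map_zero _))
  rw [← algebraMap_smul F y Φ, MvPolynomial.smul_eval] at h1
  exact (mul_eq_zero.1 h1).resolve_left hy0'

/-- The determinant of a generic linear combination of matrices. -/
def normForm {F : Type*} [Field F] {m : ℕ} (A : Fin m → Matrix (Fin m) (Fin m) F) :
    MvPolynomial (Fin (m + 1)) F :=
  Matrix.det (∑ j : Fin m, (MvPolynomial.X j.castSucc : MvPolynomial (Fin (m + 1)) F) •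
    (A j).map MvPolynomial.C)

theorem totalDegree_normForm_le {F : Type*} [Field F] {m : ℕ}
    (A : Fin m → Matrix (Fin m) (Fin m) F) : (normForm A).totalDegree ≤ m := by
  rw [normForm, Matrix.det_apply]
  refine MvPolynomial.totalDegree_finsetSum_le fun p _ => ?_
  refine (MvPolynomial.totalDegree_smul_le _ _).trans ?_
  refine (MvPolynomial.totalDegree_finsetProd _ _).trans ?_
  refine (Finset.sum_le_card_nsmul _ _ 1 fun i _ => ?_).trans (by simp)
  rw [Matrix.sum_apply]
  refine MvPolynomial.totalDegree_finsetSum_le fun j _ => ?_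
  rw [Matrix.smul_apply, Matrix.map_apply, smul_eq_mul]
  refine (MvPolynomial.totalDegree_mul _ _).trans ?_
  rw [MvPolynomial.totalDegree_X, MvPolynomial.totalDegree_C]

theorem eval_normForm {F : Type*} [Field F] {m : ℕ}
    (A : Fin m → Matrix (Fin m) (Fin m) F) (x : Fin (m + 1) → F) :
    MvPolynomial.eval x (normForm A) = Matrix.det (∑ j : Fin m, x j.castSucc • A j) := by
  rw [normForm, RingHom.map_det]
  congr 1
  ext a b
  simp [Matrix.sum_apply]

theorem exists_det_eq {C F : Type*} [Field C] [IsAlgClosed C] [Field F]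
    [Algebra C[X] F] [FaithfulSMul C[X] F] [Algebra.IsAlgebraic C[X] F] {m : ℕ} (hm : 0 < m)
    (A : Fin m → Matrix (Fin m) (Fin m) F)
    (hA : ∀ x : Fin m → F, Matrix.det (∑ j, x j • A j) = 0 → x = 0) (β : F) :
    ∃ x : Fin m → F, Matrix.det (∑ j, x j • A j) = β := by
  obtain ⟨x, hx, hx0⟩ := exists_zero_of_isAlgebraic (C := C)
    (MvPolynomial.C β * MvPolynomial.X (Fin.last m) ^ m - normForm A) (by
      rw [Nat.card_eq_fintype_card, Fintype.card_fin, Nat.lt_succ_iff]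
      refine (MvPolynomial.totalDegree_sub _ _).trans (max_le ?_ (totalDegree_normForm_le A))
      refine (MvPolynomial.totalDegree_mul _ _).trans ?_
      rw [MvPolynomial.totalDegree_C, MvPolynomial.totalDegree_X_pow, zero_add]) (by
    have : Nonempty (Fin m) := ⟨⟨0, hm⟩⟩
    rw [← MvPolynomial.eval_zero, map_sub, map_mul, map_pow, MvPolynomial.eval_X, eval_normForm]
    simp [hm.ne', Matrix.det_zero])
  rw [map_sub, map_mul, map_pow, MvPolynomial.eval_X, eval_normForm, MvPolynomial.eval_C,
    sub_eq_zero] at hx0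
  have hw : x (Fin.last m) ≠ 0 := fun hw => hx <| by
    rw [hw, zero_pow hm.ne', mul_zero] at hx0
    have := hA _ hx0.symm
    ext i
    induction i using Fin.lastCases with
    | last => exact hw
    | cast i => exact congrFun this i
  refine ⟨fun j => (x (Fin.last m))⁻¹ * x j.castSucc, ?_⟩
  simp only [mul_smul, ← Finset.smul_sum]
  rw [Matrix.det_smul, ← hx0, Fintype.card_fin]
  rw [mul_left_comm, ← mul_pow, inv_mul_cancel₀ hw, one_pow, mul_one]

end Tsen

namespace Tsen

open Polynomial

theorem exists_norm_eq {C F L M : Type*} [Field C] [IsAlgClosed C] [Field F] [Field L] [Field M]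
    [Algebra C[X] F] [FaithfulSMul C[X] F] [Algebra.IsAlgebraic C[X] F] [Algebra F L] [Algebra L M]
    (pb : PowerBasis L M) (hmin : minpoly L pb.gen ∈ lifts (algebraMap F L)) (β : F) :
    ∃ x : Fin pb.dim → F, Algebra.norm L (∑ j, algebraMap F L (x j) • pb.gen ^ (j : ℕ)) =
      algebraMap F L β := by
  obtain ⟨A₀, hA₀⟩ : ∃ A₀ : Matrix (Fin pb.dim) (Fin pb.dim) F,
      (algebraMap F L).mapMatrix A₀ = Algebra.leftMulMatrix pb.basis pb.gen := by
    have h : ∀ i j, ∃ a : F, algebraMap F L a = Algebra.leftMulMatrix pb.basis pb.gen i j := by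
      intro i j
      rw [PowerBasis.leftMulMatrix, Matrix.of_apply]
      split_ifs
      · obtain ⟨a, ha⟩ := (lifts_iff_coeff_lifts _).1 hmin i
        exact ⟨-a, by rw [map_neg, ha, PowerBasis.minpolyGen_eq]⟩
      · exact ⟨1, map_one _⟩
      · exact ⟨0, map_zero _⟩
    choose a ha using h
    exact ⟨Matrix.of a, by ext i j; exact ha i j⟩
  have key : ∀ x : Fin pb.dim → F,
      Algebra.norm L (∑ j, algebraMap F L (x j) • pb.gen ^ (j : ℕ)) =
        algebraMap F L (Matrix.det (∑ j, x j • A₀ ^ (j : ℕ))) := by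
    intro x
    rw [Algebra.norm_eq_matrix_det pb.basis, RingHom.map_det]
    congr 1
    simp only [map_sum, map_smul, map_pow, ← hA₀]
    refine Finset.sum_congr rfl fun j _ => ?_
    rw [← map_pow]
    ext a b
    simp
  obtain ⟨x, hx⟩ := exists_det_eq (C := C) pb.dim_pos (fun j => A₀ ^ (j : ℕ)) (fun x hx => by
    have h1 := key x
    have : FiniteDimensional L M := pb.finite
    rw [hx, map_zero, Algebra.norm_eq_zero_iff] at h1
    simp only [← pb.basis_eq_pow] at h1
    ext j
    have h2 := Fintype.linearIndependent_iff.1 pb.basis.linearIndependent _ h1 j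
    rwa [map_eq_zero] at h2) β
  exact ⟨x, by rw [key, hx]⟩

end Tsen

namespace MilnorRing

open Polynomial

variable {ℓ : ℕ} {Ω : Type*} [Field Ω]

/-- Restriction along an inclusion of subfields. -/
def incl (ℓ : ℕ) {L M : Subfield Ω} (h : L ≤ M) : MilnorRing ℓ L →+* MilnorRing ℓ M :=
  map ℓ (Subfield.inclusion h) (Subfield.inclusion h).injective

theorem incl_sym {L M : Subfield Ω} (h : L ≤ M) (a : L) :
    incl ℓ h (sym ℓ a) = sym ℓ (Subfield.inclusion h a) :=
  map_sym _ _ a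

theorem incl_incl {L M N : Subfield Ω} (h : L ≤ M) (h' : M ≤ N) (y : MilnorRing ℓ L) :
    incl ℓ h' (incl ℓ h y) = incl ℓ (h.trans h') y :=
  map_map _ _ _ _ _ _ (fun _ => rfl) y

theorem incl_self {L : Subfield Ω} (y : MilnorRing ℓ L) : incl ℓ (le_refl L) y = y := by
  have : incl ℓ (le_refl L) = RingHom.id _ := ringHom_ext fun a _ => incl_sym _ a
  rw [this, RingHom.id_apply]

/-- All symbols with entries in `T` annihilate `y`. -/
def Kills (T : Subfield Ω) {L : Subfield Ω} (y : MilnorRing ℓ L) : Prop :=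
  ∀ β : L, β ≠ 0 → (β : Ω) ∈ T → sym ℓ β * y = 0

/-- A relatively algebraically closed subfield of transcendence degree one over an algebraically
closed field `C`, with transcendental element `b`. -/
structure IsCurve (C : Type*) [Field C] [Algebra C Ω] (b : Ω) (T : Subfield Ω) : Prop where
  transcendental : Transcendental C b
  algebraMap_mem : ∀ c : C, algebraMap C Ω c ∈ T
  mem : b ∈ T
  isAlgebraic : ∀ x ∈ T, IsAlgebraic (Algebra.adjoin C {b}) x
  mem_of_isAlgebraic : ∀ x : Ω, IsAlgebraic T x → x ∈ T

theorem adjoin_eq_top {L L' : Subfield Ω} {e : Ω} (hL' : L' = L ⊔ Subfield.closure {e})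
    (h : L ≤ L') (he : e ∈ L') :
    letI := (Subfield.inclusion h).toAlgebra
    IntermediateField.adjoin L {(⟨e, he⟩ : L')} = ⊤ := by
  let := (Subfield.inclusion h).toAlgebra
  rw [← top_le_iff]
  intro x _
  have hle : L' ≤ (IntermediateField.adjoin L {(⟨e, he⟩ : L')}).toSubfield.map L'.subtype := by
    conv_lhs => rw [hL']
    refine sup_le (fun y hy => ?_) ((Subfield.closure_le).2 ?_)
    · exact ⟨⟨y, h hy⟩, IntermediateField.algebraMap_mem _ (⟨y, hy⟩ : L), rfl⟩
    · rintro _ rfl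
      exact ⟨⟨_, he⟩, IntermediateField.mem_adjoin_simple_self L _, rfl⟩
  obtain ⟨z, hz, hzx⟩ := hle x.2
  rwa [← Subtype.ext hzx]

theorem minpoly_mem_lifts {C : Type*} [Field C] [Algebra C Ω] {b : Ω} {T : Subfield Ω}
    (hT : IsCurve C b T) {L L' : Subfield Ω} {e : Ω} (h : L ≤ L') (he : e ∈ L')
    (heF : IsIntegral (L ⊓ T : Subfield Ω) e) :
    letI := (Subfield.inclusion h).toAlgebra
    minpoly L (⟨e, he⟩ : L') ∈ lifts (Subfield.inclusion (inf_le_left : L ⊓ T ≤ L)) := by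
  let := (Subfield.inclusion h).toAlgebra
  let := (Subfield.inclusion (inf_le_left : L ⊓ T ≤ L)).toAlgebra
  have htow : IsScalarTower L L' Ω := .of_algebraMap_eq fun _ => rfl
  have htow' : IsScalarTower (L ⊓ T : Subfield Ω) L Ω := .of_algebraMap_eq fun _ => rfl
  have h1 : minpoly L (⟨e, he⟩ : L') = minpoly L e :=
    (minpoly.algebraMap_eq (algebraMap L' Ω).injective (⟨e, he⟩ : L')).symm
  rw [h1]
  have hinteg : IsIntegral L e := heF.tower_top
  have h2 := integralClosure.mem_lifts_of_monic_of_dvd_map L (minpoly.monic heF)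
    (minpoly.monic hinteg) (minpoly.dvd_map_of_isScalarTower (L ⊓ T : Subfield Ω) L e)
  rw [lifts_iff_coeff_lifts] at h2 ⊢
  intro n
  obtain ⟨⟨x, hx⟩, hx'⟩ := h2 n
  rw [← hx']
  refine ⟨⟨(x : Ω), x.2, hT.mem_of_isAlgebraic _ ?_⟩, rfl⟩
  have hx1 : IsIntegral (L ⊓ T : Subfield Ω) (algebraMap L Ω x) := IsIntegral.algebraMap hx
  let := (Subfield.inclusion (inf_le_right : L ⊓ T ≤ T)).toAlgebra
  have htow'' : IsScalarTower (L ⊓ T : Subfield Ω) T Ω := .of_algebraMap_eq fun _ => rfl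
  exact (hx1.tower_top (A := T)).isAlgebraic

theorem Kills.of_adjoin {C : Type*} [Field C] [IsAlgClosed C] [Algebra C Ω] {b : Ω}
    {T : Subfield Ω} (hT : IsCurve C b T) {L L' : Subfield Ω} (hCL : ∀ c, algebraMap C Ω c ∈ L)
    (hb : b ∈ L) {e : Ω} (heT : e ∈ T) (hL' : L' = L ⊔ Subfield.closure {e}) (h : L ≤ L')
    {y : MilnorRing ℓ L} (hy : Kills T (incl ℓ h y)) : Kills T y := by
  intro β hβ hβT
  let F : Subfield Ω := L ⊓ T
  let φ : C[X] →+* F := eval₂RingHom ((algebraMap C Ω).codRestrict F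
    fun c => ⟨hCL c, hT.algebraMap_mem c⟩) ⟨b, hb, hT.mem⟩
  have hφ : ∀ p, (φ p : Ω) = aeval b p := fun p => by
    have : F.subtype.comp φ = (aeval b : C[X] →ₐ[C] Ω).toRingHom := by
      ext x
      · simp only [φ, RingHom.comp_apply, coe_eval₂RingHom, eval₂_C]
        exact (aeval_C b x).symm
      · simp [φ]
    exact RingHom.congr_fun this p
  let : Algebra C[X] F := φ.toAlgebra
  let : Algebra C[X] Ω := (aeval b : C[X] →ₐ[C] Ω).toRingHom.toAlgebra
  have htow : IsScalarTower C[X] F Ω := .of_algebraMap_eq fun p => (hφ p).symm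
  have hinj : Function.Injective φ := fun p q hpq => by
    refine (transcendental_iff_injective.1 hT.transcendental) ?_
    rw [← hφ, ← hφ, hpq]
  have : FaithfulSMul C[X] F := (faithfulSMul_iff_algebraMap_injective _ _).2 hinj
  have hTalg : ∀ x ∈ T, IsAlgebraic C[X] x := fun x hx => by
    have hmem : ∀ p : C[X], aeval b p ∈ Algebra.adjoin C {b} := fun p =>
      aeval_mem_adjoin_singleton C b
    refine (hT.isAlgebraic x hx).of_ringHom_of_comp_eq
      ((aeval b : C[X] →ₐ[C] Ω).codRestrict (Algebra.adjoin C {b}) hmem) (RingHom.id Ω) ?_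
      Function.injective_id (by ext <;> rfl)
    rintro ⟨z, hz⟩
    rw [Algebra.adjoin_singleton_eq_range_aeval] at hz
    obtain ⟨p, hp⟩ := hz
    exact ⟨p, Subtype.ext hp⟩
  have : Algebra.IsAlgebraic C[X] F := ⟨fun x =>
    (isAlgebraic_algebraMap_iff (algebraMap F Ω).injective).1 (hTalg x x.2.2)⟩
  have heF : IsIntegral F e :=
    isAlgebraic_iff_isIntegral.1 ((hTalg e heT).extendScalars hinj)
  have he : e ∈ L' := hL' ▸ (le_sup_right : _ ≤ L ⊔ Subfield.closure {e})
    (Subfield.subset_closure rfl)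
  have hmin := minpoly_mem_lifts hT h he heF
  let : Algebra L L' := (Subfield.inclusion h).toAlgebra
  let : Algebra F L := (Subfield.inclusion (inf_le_left : L ⊓ T ≤ L)).toAlgebra
  have htow2 : IsScalarTower L L' Ω := .of_algebraMap_eq fun _ => rfl
  have htow3 : IsScalarTower F L Ω := .of_algebraMap_eq fun _ => rfl
  have htop := adjoin_eq_top hL' h he
  have hinteg : IsIntegral L (⟨e, he⟩ : L') :=
    (isIntegral_algebraMap_iff (algebraMap L' Ω).injective).1 (heF.tower_top (A := L))
  have htopA : Algebra.adjoin L {(⟨e, he⟩ : L')} = ⊤ := by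
    rw [← IntermediateField.adjoin_simple_toSubalgebra_of_isAlgebraic hinteg.isAlgebraic, htop]
    rfl
  let pb : PowerBasis L L' := PowerBasis.ofAdjoinEqTop hinteg htopA
  have hgen : pb.gen = ⟨e, he⟩ := PowerBasis.ofAdjoinEqTop_gen hinteg htopA
  have : FiniteDimensional L L' := pb.finite
  obtain ⟨x, hx⟩ := Tsen.exists_norm_eq (C := C) (F := F) pb (hgen ▸ hmin) ⟨β, β.2, hβT⟩
  set β' : L' := ∑ j, algebraMap F L (x j) • pb.gen ^ (j : ℕ) with hβ'
  have hx' : Algebra.norm L β' = β := hx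
  have hβ'0 : β' ≠ 0 := fun h0 => hβ (by rw [← hx', h0, Algebra.norm_zero])
  have hβ'T : (β' : Ω) ∈ T := by
    rw [hβ', hgen]
    have : ((∑ j, algebraMap F L (x j) • (⟨e, he⟩ : L') ^ (j : ℕ) : L') : Ω) =
        ∑ j, (x j : Ω) * e ^ (j : ℕ) := by
      rw [← Subfield.coe_subtype, map_sum]
      rfl
    rw [this]
    exact sum_mem fun j _ => mul_mem (x j).2.2 (pow_mem heT _)
  rw [← hx']
  exact sym_norm_mul_eq_zero htop hβ'0 (hy β' hβ'0 hβ'T)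

end MilnorRing

namespace MilnorRing

open Filter

variable {ℓ : ℕ} {Ω : Type*} [Field Ω]

section Compactness

variable {ι : Type*} [SemilatticeSup ι]

/-- Equality of germs at infinity. -/
def germCon {ι : Type*} [SemilatticeSup ι] (R : ι → Type*) [∀ i, Ring (R i)] :
    RingCon (∀ i, R i) where
  r f g := ∀ᶠ i in atTop, f i = g i
  iseqv := ⟨fun _ => .of_forall fun _ => rfl, fun h => h.mono fun _ => Eq.symm,
    fun h h' => (h.and h').mono fun _ hi => hi.1.trans hi.2⟩
  mul' h h' := (h.and h').mono fun _ hi => congrArg₂ (· * ·) hi.1 hi.2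
  add' h h' := (h.and h').mono fun _ hi => congrArg₂ (· + ·) hi.1 hi.2

theorem germ_eq {R : ι → Type*} [∀ i, Ring (R i)] {f g : ∀ i, R i} :
    (germCon R).mk' f = (germCon R).mk' g ↔ ∀ᶠ i in atTop, f i = g i :=
  (germCon R).eq

theorem exists_incl_eq_zero [Nonempty ι] {S : ι → Subfield Ω} (hS : Monotone S) {L M : Subfield Ω}
    (hL : ∀ i, L ≤ S i) (hLM : L ≤ M) (hM : M ≤ ⨆ i, S i) {y : MilnorRing ℓ L}
    (hy : incl ℓ hLM y = 0) : ∃ i, incl ℓ (hL i) y = 0 := by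
  classical
  have hev : ∀ x ∈ M, ∀ᶠ i in atTop, x ∈ S i := fun x hx => by
    obtain ⟨i, hi⟩ := (Subfield.mem_iSup_of_directed hS.directed_le).1 (hM hx)
    exact (eventually_ge_atTop i).mono fun j hj => hS hj hi
  let R : ι → Type _ := fun i => MilnorRing ℓ (S i)
  let s : ∀ (x : M) (i : ι), R i := fun x i => if h : (x : Ω) ∈ S i then sym ℓ ⟨x, h⟩ else 0
  have hs : ∀ (x : M) (i : ι) (h : (x : Ω) ∈ S i), s x i = sym ℓ (⟨x, h⟩ : S i) :=
    fun x i h => dif_pos h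
  have hne : ∀ (x : M) (i : ι) (h : (x : Ω) ∈ S i), x ≠ 0 → (⟨(x : Ω), h⟩ : S i) ≠ (0 : S i) :=
    fun x i h hx h0 => hx (Subtype.ext (congrArg (S i).subtype h0))
  let Ψ : MilnorRing ℓ M →+* (germCon R).Quotient := lift (fun x => (germCon R).mk' (s x))
    (by
      rw [← map_zero (germCon R).mk', germ_eq]
      refine .of_forall fun i => ?_
      rw [hs 0 i (zero_mem _)]
      exact sym_zero)
    (fun a b ha hb => by
      rw [← map_add (germCon R).mk', germ_eq]
      filter_upwards [hev a a.2, hev b b.2] with i hai hbi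
      rw [Pi.add_apply, hs a i hai, hs b i hbi, hs (a * b) i (mul_mem hai hbi)]
      exact sym_mul (D := S i) (hne a i hai ha) (hne b i hbi hb))
    (fun a b ha hb hab => by
      rw [← map_zero (germCon R).mk', ← map_sub (germCon R).mk', ← map_sub (germCon R).mk',
        ← map_mul (germCon R).mk', germ_eq]
      filter_upwards [hev a a.2, hev b b.2] with i hai hbi
      rw [Pi.mul_apply, Pi.sub_apply, Pi.sub_apply, hs a i hai, hs b i hbi,
        hs (a + b) i (add_mem hai hbi)]
      exact steinberg (D := S i) (hne a i hai ha) (hne b i hbi hb)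
        (hne (a + b) i (add_mem hai hbi) hab) rfl)
    (by
      rw [← map_natCast (germCon R).mk', ← map_zero (germCon R).mk', germ_eq]
      exact .of_forall fun i => natCast_eq_zero)
  have key : Ψ.comp (incl ℓ hLM) = (germCon R).mk'.comp (RingHom.pi fun i => incl ℓ (hL i)) :=
    ringHom_ext fun a _ => by
      rw [RingHom.comp_apply, incl_sym, lift_sym, RingHom.comp_apply, germ_eq]
      refine .of_forall fun i => ?_
      rw [hs _ i (hL i a.2)]
      exact (incl_sym (hL i) a).symm
  have h1 := RingHom.congr_fun key y
  rw [RingHom.comp_apply, hy, map_zero, ← map_zero (germCon R).mk', RingHom.comp_apply,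
    germ_eq] at h1
  obtain ⟨i, hi⟩ := h1.exists
  exact ⟨i, hi.symm⟩

end Compactness

theorem exists_finset_incl_eq_zero {L T : Subfield Ω} {y : MilnorRing ℓ L}
    (hy : incl ℓ (le_sup_left : L ≤ L ⊔ T) y = 0) : ∃ s : Finset Ω, (s : Set Ω) ⊆ T ∧
      incl ℓ (le_sup_left : L ≤ L ⊔ Subfield.closure (s : Set Ω)) y = 0 := by
  classical
  let S : {s : Finset Ω // (s : Set Ω) ⊆ T} → Subfield Ω := fun s =>
    L ⊔ Subfield.closure (s.1 : Set Ω)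
  have hmono : Monotone S := fun s t hst =>
    sup_le_sup_left (Subfield.closure_mono (Finset.coe_subset.2 hst)) L
  let _ : SemilatticeSup {s : Finset Ω // (s : Set Ω) ⊆ T} :=
    Subtype.semilatticeSup fun {s t} hs ht => by
      rw [Finset.sup_eq_union, Finset.coe_union]
      exact Set.union_subset hs ht
  have : Nonempty {s : Finset Ω // (s : Set Ω) ⊆ T} := ⟨∅, by simp⟩
  obtain ⟨⟨s, hs⟩, h⟩ := exists_incl_eq_zero hmono (fun _ => le_sup_left) le_sup_left
    (sup_le (le_sup_left.trans (le_iSup S ⟨∅, by simp⟩)) fun x hx => by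
      have hx' : ((({x} : Finset Ω)) : Set Ω) ⊆ T := by simpa using hx
      exact (le_sup_right.trans (le_iSup S ⟨{x}, hx'⟩)) (Subfield.subset_closure (by simp))) hy
  exact ⟨s, hs, h⟩

theorem Kills.of_finset {C : Type*} [Field C] [IsAlgClosed C] [Algebra C Ω] {b : Ω}
    {T : Subfield Ω} (hT : IsCurve C b T) (s : Finset Ω) (hs : (s : Set Ω) ⊆ T) {L : Subfield Ω}
    (hCL : ∀ c, algebraMap C Ω c ∈ L) (hb : b ∈ L) {y : MilnorRing ℓ L}
    (hy : incl ℓ (le_sup_left : L ≤ L ⊔ Subfield.closure (s : Set Ω)) y = 0) : Kills T y := by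
  classical
  suffices ∀ (M : Subfield Ω) (h : L ≤ M) (_ : M = L ⊔ Subfield.closure (s : Set Ω)),
      incl ℓ h y = 0 → Kills T y from this _ _ rfl hy
  clear hy
  induction s using Finset.induction_on generalizing L with
  | empty =>
    intro M h hM hy
    have : M = L := by simpa using hM
    subst this
    rw [incl_self] at hy
    intro β _ _
    rw [hy, mul_zero]
  | insert e s he ih =>
    intro M h hM hy
    rw [Finset.coe_insert, Set.insert_subset_iff] at hs
    rw [Finset.coe_insert, Set.insert_eq, Subfield.closure_union, ← sup_assoc] at hM
    refine Kills.of_adjoin hT hCL hb hs.1 rfl le_sup_left ?_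
    have hle : L ≤ L ⊔ Subfield.closure {e} := le_sup_left
    exact ih hs.2 (fun c => hle (hCL c)) (hle hb) M (hM ▸ le_sup_left) hM (by
      rw [incl_incl, hy])

theorem IsCurve.sym_mul_eq_zero {C : Type*} [Field C] [IsAlgClosed C] [Algebra C Ω] {b : Ω}
    {T : Subfield Ω} (hT : IsCurve C b T) {L : Subfield Ω} (hCL : ∀ c, algebraMap C Ω c ∈ L)
    (hb : b ∈ L) {y : MilnorRing ℓ L} (hy : incl ℓ (le_sup_left : L ≤ L ⊔ T) y = 0) :
    sym ℓ (⟨b, hb⟩ : L) * y = 0 := by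
  obtain ⟨s, hs, h⟩ := exists_finset_incl_eq_zero hy
  by_cases hb0 : b = 0
  · have : (⟨b, hb⟩ : L) = 0 := Subtype.ext hb0
    rw [this, sym_zero, zero_mul]
  · exact Kills.of_finset hT s hs hCL hb h _ (fun h0 => hb0 (congrArg Subtype.val h0)) hT.mem

end MilnorRing

namespace MilnorRing

variable {ℓ : ℕ} {Ω : Type*} [Field Ω]

theorem _root_.IsAlgebraic.of_subring_le {A B : Subring Ω} (hAB : A ≤ B) {x : Ω}
    (h : IsAlgebraic A x) : IsAlgebraic B x := by
  let : Algebra A B := (Subring.inclusion hAB).toAlgebra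
  have : IsScalarTower A B Ω := .of_algebraMap_eq fun _ => rfl
  exact h.extendScalars (Subring.inclusion_injective hAB)

/-- The algebraic closure in `Ω` of the field generated over `k` by a set. -/
def algClosureAdjoin (k : Type*) [Field k] [Algebra k Ω] (s : Set Ω) : Subfield Ω :=
  (algebraicClosure (IntermediateField.adjoin k s) Ω).toSubfield

section

variable {k : Type*} [Field k] [Algebra k Ω] {s t : Set Ω}

theorem mem_algClosureAdjoin {x : Ω} :
    x ∈ algClosureAdjoin k s ↔ IsAlgebraic (Algebra.adjoin k s) x := by
  rw [← IntermediateField.isAlgebraic_adjoin_iff]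
  exact mem_algebraicClosure_iff

theorem subset_algClosureAdjoin : s ⊆ algClosureAdjoin k s := fun x hx =>
  mem_algClosureAdjoin.2 (isAlgebraic_algebraMap
    (⟨x, Algebra.subset_adjoin hx⟩ : Algebra.adjoin k s))

theorem algebraMap_mem_algClosureAdjoin (c : k) : algebraMap k Ω c ∈ algClosureAdjoin k s :=
  mem_algClosureAdjoin.2 (isAlgebraic_algebraMap
    (⟨algebraMap k Ω c, Subalgebra.algebraMap_mem _ c⟩ : Algebra.adjoin k s))

theorem mem_algClosureAdjoin_of_isAlgebraic {x : Ω} (h : IsAlgebraic (algClosureAdjoin k s) x) :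
    x ∈ algClosureAdjoin k s := by
  have h' : IsAlgebraic (algebraicClosure (IntermediateField.adjoin k s) Ω) x := h
  exact mem_algebraicClosure_iff.2 (h'.restrictScalars (IntermediateField.adjoin k s))

theorem algClosureAdjoin_le (h : s ⊆ algClosureAdjoin k t) :
    algClosureAdjoin k s ≤ algClosureAdjoin k t := fun x hx => by
  refine mem_algClosureAdjoin_of_isAlgebraic ?_
  have hle : (Algebra.adjoin k s).toSubring ≤ (algClosureAdjoin k t).toSubring := fun z hz =>
    Algebra.adjoin_induction (p := fun x _ => x ∈ algClosureAdjoin k t) (fun x hx => h hx)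
      algebraMap_mem_algClosureAdjoin (fun _ _ _ _ => add_mem) (fun _ _ _ _ => mul_mem) hz
  exact IsAlgebraic.of_subring_le hle (mem_algClosureAdjoin.1 hx)

theorem isAlgClosed_algClosureAdjoin [IsAlgClosed Ω] : IsAlgClosed (algClosureAdjoin k s) := by
  have : IsAlgClosed (algebraicClosure (IntermediateField.adjoin k s) Ω) :=
    IsAlgClosure.isAlgClosed (IntermediateField.adjoin k s)
  let e : algebraicClosure (IntermediateField.adjoin k s) Ω ≃+* algClosureAdjoin k s :=
    { toFun := fun x => ⟨x, x.2⟩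
      invFun := fun x => ⟨x, x.2⟩
      map_mul' := fun _ _ => rfl
      map_add' := fun _ _ => rfl }
  exact IsAlgClosed.of_ringEquiv _ _ e

theorem isAlgebraic_adjoin_of_mem_algClosureAdjoin {b x : Ω}
    (hx : x ∈ algClosureAdjoin k (insert b s)) :
    IsAlgebraic (Algebra.adjoin (algClosureAdjoin k s) {b}) x := by
  have hk : ∀ c : k, algebraMap k Ω c ∈ algClosureAdjoin k s := algebraMap_mem_algClosureAdjoin
  have hs : s ⊆ algClosureAdjoin k s := subset_algClosureAdjoin
  generalize algClosureAdjoin k s = C at hk hs ⊢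
  have hC : ∀ x ∈ C, x ∈ Algebra.adjoin C {b} := fun x hx =>
    Subalgebra.algebraMap_mem (Algebra.adjoin C {b}) (⟨x, hx⟩ : C)
  have hle : (Algebra.adjoin k (insert b s)).toSubring ≤ (Algebra.adjoin C {b}).toSubring := by
    intro z hz
    refine Algebra.adjoin_induction (p := fun x _ => x ∈ Algebra.adjoin C {b}) (fun x hx => ?_)
      (fun c => hC _ (hk c)) (fun _ _ _ _ => add_mem) (fun _ _ _ _ => mul_mem) hz
    obtain rfl | hx := hx
    · exact Algebra.subset_adjoin rfl
    · exact hC _ (hs hx)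
  exact IsAlgebraic.of_subring_le hle (mem_algClosureAdjoin.1 hx)

theorem isCurve_algClosureAdjoin {b : Ω} (hb : b ∉ algClosureAdjoin k s) :
    IsCurve (algClosureAdjoin k s) b (algClosureAdjoin k (insert b s)) where
  transcendental h := hb (mem_algClosureAdjoin_of_isAlgebraic h)
  algebraMap_mem c := algClosureAdjoin_le
    ((Set.subset_insert b s).trans subset_algClosureAdjoin) c.2
  mem := subset_algClosureAdjoin (Set.mem_insert b s)
  isAlgebraic _ := isAlgebraic_adjoin_of_mem_algClosureAdjoin
  mem_of_isAlgebraic _ := mem_algClosureAdjoin_of_isAlgebraic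

theorem exists_algebraMap_eq_of_mem_algClosureAdjoin_empty [IsAlgClosed k] {x : Ω}
    (hx : x ∈ algClosureAdjoin k (∅ : Set Ω)) : ∃ c, algebraMap k Ω c = x := by
  have h1 := mem_algClosureAdjoin.1 hx
  have h2 : IsAlgebraic k x := by
    rw [Algebra.adjoin_empty] at h1
    refine h1.of_ringHom_of_comp_eq (Algebra.ofId k (⊥ : Subalgebra k Ω)).toRingHom
      (RingHom.id Ω) ?_ Function.injective_id (by ext; rfl)
    rintro ⟨_, c, rfl⟩
    exact ⟨c, rfl⟩
  obtain ⟨c, hc⟩ := IsAlgClosed.algebraMap_bijective_of_isIntegral (k := k)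
    (K := integralClosure k Ω) |>.2 ⟨x, h2.isIntegral⟩
  exact ⟨c, congrArg Subtype.val hc⟩

end

theorem incl_injective_of_le {L M : Subfield Ω} (h : L ≤ M) (h' : M ≤ L) {y : MilnorRing ℓ L}
    (hy : incl ℓ h y = 0) : y = 0 := by
  have := incl_incl h h' y
  rwa [hy, map_zero, incl_self, eq_comm] at this

theorem incl_eq_zero_of_le {L M N : Subfield Ω} (h : L ≤ M) (h' : M ≤ N) {y : MilnorRing ℓ L}
    (hy : incl ℓ h y = 0) : incl ℓ (h.trans h') y = 0 := by
  rw [← incl_incl h h', hy, map_zero]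

theorem prod_sym_mul_eq_zero {k : Type*} [Field k] [IsAlgClosed k] [Algebra k Ω] [IsAlgClosed Ω]
    {L : Subfield Ω} (hL : ∀ c, algebraMap k Ω c ∈ L) (b : ℕ → L) (n : ℕ) {y : MilnorRing ℓ L}
    (hy : incl ℓ (le_sup_left : L ≤ L ⊔ algClosureAdjoin k ((fun i => (b i : Ω)) '' Set.Iio n))
      y = 0) :
    ((List.range n).map fun i => sym ℓ (b i)).prod * y = 0 := by
  induction n generalizing y with
  | zero =>
    have : y = 0 := incl_injective_of_le _ (sup_le le_rfl fun x hx => by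
      rw [← Nat.bot_eq_zero, Set.Iio_bot, Set.image_empty] at hx
      obtain ⟨c, rfl⟩ := exists_algebraMap_eq_of_mem_algClosureAdjoin_empty hx
      exact hL c) hy
    rw [this, mul_zero]
  | succ n ih =>
    rw [List.range_succ, List.map_append, List.prod_append, List.map_singleton,
      List.prod_singleton, mul_assoc]
    refine ih ?_
    have hset : (fun i => (b i : Ω)) '' Set.Iio (n + 1) =
        insert (b n : Ω) ((fun i => (b i : Ω)) '' Set.Iio n) := by
      rw [← Order.succ_eq_add_one, Order.Iio_succ_eq_insert, Set.image_insert_eq]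
    rw! [hset] at hy
    generalize (fun i => (b i : Ω)) '' Set.Iio n = s at hy ⊢
    rw [map_mul, incl_sym]
    by_cases hb : (b n : Ω) ∈ algClosureAdjoin k s
    · have : incl ℓ (le_sup_left : L ≤ L ⊔ algClosureAdjoin k s) y = 0 :=
        incl_eq_zero_of_le _ (sup_le_sup_left (algClosureAdjoin_le
          (Set.insert_subset hb subset_algClosureAdjoin)) L) hy
      rw [this, mul_zero]
    · have := isAlgClosed_algClosureAdjoin (k := k) (s := s)
      refine (isCurve_algClosureAdjoin hb).sym_mul_eq_zero
        (fun c => (le_sup_right : _ ≤ L ⊔ algClosureAdjoin k s) c.2)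
        ((le_sup_left : L ≤ L ⊔ algClosureAdjoin k s) (b n).2) ?_
      rw [incl_incl]
      exact incl_eq_zero_of_le _ (sup_le_sup_right le_sup_left _) hy

theorem incl_sym_eq_zero (hℓ : ℓ ≠ 0) {T : Subfield Ω} [IsAlgClosed T] {L M : Subfield Ω}
    (h : L ≤ M) (hT : T ≤ M) (b : L) (hb : (b : Ω) ∈ T) : incl ℓ h (sym ℓ b) = 0 := by
  obtain ⟨c, hc⟩ := IsAlgClosed.exists_pow_nat_eq (⟨b, hb⟩ : T) hℓ.bot_lt
  have hb' : Subfield.inclusion h b = Subfield.inclusion hT c ^ ℓ :=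
    Subtype.ext (congrArg T.subtype hc).symm
  rw [incl_sym, hb']
  by_cases h0 : Subfield.inclusion hT c = 0
  · rw [h0, zero_pow hℓ, sym_zero]
  · rw [sym_pow h0, nsmul_eq_mul, natCast_eq_zero, zero_mul]

end MilnorRing

namespace MilnorRing

variable {ℓ : ℕ}

theorem exists_mem_algClosureAdjoin {k Ω : Type*} [Field k] [Field Ω] [Algebra k Ω] {b : ℕ → Ω}
    {s : ℕ} (h : ¬ AlgebraicIndepOn k b (Set.Iio s)) :
    ∃ m < s, b m ∈ algClosureAdjoin k (b '' Set.Iio m) := by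
  by_contra! hc
  refine h ?_
  clear h
  induction s with
  | zero =>
    rw [← Nat.bot_eq_zero, Set.Iio_bot]
    have : IsEmpty (∅ : Set ℕ) := inferInstance
    exact algebraicIndependent_empty_type_iff.2 (algebraMap k Ω).injective
  | succ s ih =>
    rw [← Order.succ_eq_add_one, Order.Iio_succ_eq_insert]
    exact (ih fun m hm => hc m (hm.trans s.lt_succ_self)).insert
      fun halg => hc s s.lt_succ_self (mem_algClosureAdjoin.2 halg)

theorem prod_sym_eq_zero {k K : Type*} [Field k] [Field K] [Algebra k K] [IsAlgClosed k]
    (hℓ : ℓ ≠ 0) (b : ℕ → K) (s : ℕ) (h : ¬ AlgebraicIndepOn k b (Set.Iio s)) :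
    ((List.range s).map fun i => sym ℓ (b i)).prod = 0 := by
  let Ω := AlgebraicClosure K
  let L : Subfield Ω := (algebraMap K Ω).fieldRange
  let f : K →+* L := (algebraMap K Ω).rangeRestrictField
  have hf : Function.Bijective f :=
    ⟨f.injective, fun ⟨_, x, hx⟩ => ⟨x, Subtype.ext hx⟩⟩
  let g : L →+* K := (RingEquiv.ofBijective f hf).symm.toRingHom
  have hgf : ∀ x, g (f x) = x := (RingEquiv.ofBijective f hf).symm_apply_apply
  have hmap : (map ℓ g g.injective).comp (map ℓ f f.injective) = RingHom.id _ :=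
    ringHom_ext fun a _ => by
      rw [RingHom.comp_apply, map_sym, map_sym, hgf, RingHom.id_apply]
  obtain ⟨m, hm, hmem⟩ := exists_mem_algClosureAdjoin (k := k) (b := fun i => algebraMap K Ω (b i))
    (s := s) fun h' => h (AlgebraicIndependent.of_comp (IsScalarTower.toAlgHom k K Ω) h')
  obtain ⟨r, rfl⟩ := Nat.exists_eq_add_of_lt hm
  rw [Nat.add_right_comm, List.range_add, List.map_append, List.prod_append, List.range_succ,
    List.map_append, List.prod_append, List.map_singleton, List.prod_singleton]
  have hL : ∀ c, algebraMap k Ω c ∈ L := fun c => ⟨algebraMap k K c,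
    (IsScalarTower.algebraMap_apply k K Ω c).symm⟩
  have := isAlgClosed_algClosureAdjoin (k := k)
    (s := (fun i => algebraMap K Ω (b i)) '' Set.Iio m)
  have key := prod_sym_mul_eq_zero (ℓ := ℓ) hL (fun i => f (b i)) m (y := sym ℓ (f (b m)))
    (incl_sym_eq_zero hℓ (T := algClosureAdjoin k ((fun i => algebraMap K Ω (b i)) '' Set.Iio m))
      _ le_sup_right _ hmem)
  have hzero := congrArg (map ℓ g g.injective) key
  simp only [map_mul, map_list_prod, List.map_map, Function.comp_def, map_sym, hgf, map_zero]
    at hzero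
  rw [hzero, zero_mul]

theorem not_algebraicIndepOn_of_lt {k K : Type*} [Field k] [Field K] [Algebra k K] {d : ℕ}
    {x : Fin d → K} (hx : IsTranscendenceBasis k x) {s : ℕ} (hs : d < s) (b : ℕ → K) :
    ¬ AlgebraicIndepOn k b (Set.Iio s) := fun h => by
  have h1 := h.lift_cardinalMk_le_trdeg
  have h2 := hx.lift_cardinalMk_eq_trdeg
  rw [Cardinal.mk_fin, Cardinal.lift_natCast] at h2
  have h3 : Cardinal.mk (Set.Iio s) = s := by simp
  rw [h3, Cardinal.lift_natCast] at h1
  have h4 : (d : Cardinal) = Algebra.trdeg k K := by simpa using h2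
  have h5 : (s : Cardinal) ≤ Algebra.trdeg k K := by simpa using h1
  rw [← h4, Nat.cast_le] at h5
  omega

end MilnorRing

section MilnorKMod

variable {ℓ : ℕ} {K : Type*} [Field K]

/-- Left multiplication by a unit on tensor powers. -/
def MilnorPre.cons (n : ℕ) (K : Type*) [Field K] :
    Additive Kˣ →ₗ[ℤ] MilnorPre n K →ₗ[ℤ] MilnorPre (n + 1) K :=
  (PiTensorProduct.lift (R := ℤ) (s := fun _ : Fin n => Additive Kˣ)).toLinearMap ∘ₗ
    (PiTensorProduct.tprod ℤ (s := fun _ : Fin (n + 1) => Additive Kˣ)).curryLeft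

theorem MilnorPre.cons_tprod {n : ℕ} (a : Additive Kˣ) (v : Fin n → Additive Kˣ) :
    MilnorPre.cons n K a (PiTensorProduct.tprod ℤ v) =
      PiTensorProduct.tprod ℤ (Fin.cons a v : Fin (n + 1) → Additive Kˣ) :=
  PiTensorProduct.lift.tprod _

theorem SteinbergRel_le_comap_cons {n : ℕ} (a : Additive Kˣ) :
    SteinbergRel n K ≤ (SteinbergRel (n + 1) K).comap (MilnorPre.cons n K a) := by
  refine Submodule.span_le.2 ?_
  rintro _ ⟨v, ⟨i, j, hij, h⟩, rfl⟩
  rw [SetLike.mem_coe, Submodule.mem_comap, MilnorPre.cons_tprod]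
  refine Submodule.subset_span ⟨Fin.cons a.toMul v, ⟨i.succ, j.succ, Fin.succ_lt_succ_iff.2 hij,
    by simpa using h⟩, ?_⟩
  congr 1

/-- Left multiplication by a unit on mod-`ℓ` Milnor K-theory. -/
def MilnorKMod.cons (ℓ n : ℕ) {K : Type*} [Field K] (a : Kˣ) :
    MilnorKMod ℓ n K →ₗ[ℤ] MilnorKMod ℓ (n + 1) K :=
  Submodule.mapQ _ _ (Submodule.mapQ _ _ (MilnorPre.cons n K (Additive.ofMul a))
    (SteinbergRel_le_comap_cons _)) (by
      rintro _ ⟨y, rfl⟩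
      exact ⟨Submodule.mapQ _ _ (MilnorPre.cons n K (Additive.ofMul a))
        (SteinbergRel_le_comap_cons _) y, by simp⟩)

theorem MilnorKMod.cons_milnorSymbol {n : ℕ} (a : Kˣ) (v : Fin n → Kˣ) :
    MilnorKMod.cons ℓ n a (milnorSymbol ℓ v) = milnorSymbol ℓ (Fin.cons a v : Fin (n + 1) → Kˣ) := by
  change Submodule.Quotient.mk (Submodule.Quotient.mk (MilnorPre.cons n K (Additive.ofMul a)
    (PiTensorProduct.tprod ℤ fun i => Additive.ofMul (v i)))) = _
  rw [MilnorPre.cons_tprod, milnorSymbol]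
  congr 3

theorem MilnorKMod.hom_ext {n : ℕ} {N : Type*} [AddCommGroup N]
    {f g : MilnorKMod ℓ n K →ₗ[ℤ] N}
    (h : ∀ v : Fin n → Kˣ, f (milnorSymbol ℓ v) = g (milnorSymbol ℓ v)) : f = g := by
  refine Submodule.linearMap_qext _ (Submodule.linearMap_qext _ (PiTensorProduct.ext ?_))
  exact MultilinearMap.ext fun v => h fun i => (v i).toMul

theorem MilnorKMod.natCast_nsmul {n : ℕ} (x : MilnorKMod ℓ n K) : ℓ • x = 0 := by
  obtain ⟨y, rfl⟩ := Submodule.Quotient.mk_surjective _ x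
  refine (Submodule.Quotient.mk_eq_zero _).2 ⟨y, ?_⟩
  exact natCast_zsmul y ℓ

theorem MilnorKMod.cons_mul (n : ℕ) (a b : Kˣ) :
    MilnorKMod.cons ℓ n (a * b) = MilnorKMod.cons ℓ n a + MilnorKMod.cons ℓ n b := by
  refine Submodule.linearMap_qext _ (Submodule.linearMap_qext _ (LinearMap.ext fun x => ?_))
  change Submodule.Quotient.mk (Submodule.Quotient.mk
    (MilnorPre.cons n K (Additive.ofMul a + Additive.ofMul b) x)) = _
  rw [map_add]
  rfl

theorem MilnorKMod.cons_cons_of_add_eq_one (n : ℕ) {a b : Kˣ} (h : (a : K) + b = 1) :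
    MilnorKMod.cons ℓ (n + 1) a ∘ₗ MilnorKMod.cons ℓ n b = 0 := by
  refine MilnorKMod.hom_ext fun v => ?_
  rw [LinearMap.comp_apply, cons_milnorSymbol, cons_milnorSymbol, LinearMap.zero_apply]
  have : (Submodule.Quotient.mk (PiTensorProduct.tprod ℤ fun i => Additive.ofMul
      ((Fin.cons a (Fin.cons b v : Fin (n + 1) → Kˣ) : Fin (n + 2) → Kˣ) i)) :
      MilnorK (n + 2) K) = 0 :=
    (Submodule.Quotient.mk_eq_zero _).2 (Submodule.subset_span
      ⟨_, ⟨0, 1, Fin.zero_lt_one, h⟩, rfl⟩)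
  rw [milnorSymbol, this, Submodule.Quotient.mk_zero]

/-- The mod-`ℓ` Milnor K-groups as a graded family of additive groups. -/
def MilnorKMod.Degree (ℓ : ℕ) (K : Type*) [Field K] (n : ℕ) : Type _ := MilnorKMod ℓ n K

instance (ℓ : ℕ) (K : Type*) [Field K] (n : ℕ) : AddCommGroup (MilnorKMod.Degree ℓ K n) :=
  inferInstanceAs (AddCommGroup (MilnorKMod ℓ n K))

/-- Left multiplication by a unit in each degree. -/
def MilnorKMod.consHom (ℓ : ℕ) {K : Type*} [Field K] (a : Kˣ) (n : ℕ) :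
    MilnorKMod.Degree ℓ K n →+ MilnorKMod.Degree ℓ K (n + 1) :=
  (MilnorKMod.cons ℓ n a).toAddMonoidHom

/-- Left multiplication by a unit as an endomorphism of the product of all mod-`ℓ` Milnor
K-groups. -/
def MilnorKMod.shift (ℓ : ℕ) {K : Type*} [Field K] (a : Kˣ) :
    AddMonoid.End (∀ n, MilnorKMod.Degree ℓ K n) where
  toFun v
    | 0 => 0
    | n + 1 => MilnorKMod.consHom ℓ a n (v n)
  map_zero' := funext fun
    | 0 => rfl
    | n + 1 => map_zero (MilnorKMod.consHom ℓ a n)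
  map_add' v w := funext fun
    | 0 => (add_zero _).symm
    | n + 1 => map_add (MilnorKMod.consHom ℓ a n) (v n) (w n)

theorem MilnorKMod.shift_mul (a b : Kˣ) :
    MilnorKMod.shift ℓ (a * b) = MilnorKMod.shift ℓ a + MilnorKMod.shift ℓ b := by
  refine AddMonoidHom.ext fun v => funext fun n => ?_
  cases n with
  | zero => exact (add_zero _).symm
  | succ n => exact LinearMap.congr_fun (cons_mul n a b) (v n)

theorem MilnorKMod.shift_mul_shift_of_add_eq_one {a b : Kˣ} (h : (a : K) + b = 1) :
    MilnorKMod.shift ℓ a * MilnorKMod.shift ℓ b = 0 := by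
  refine AddMonoidHom.ext fun v => funext fun n => ?_
  match n with
  | 0 => rfl
  | 1 => exact map_zero (MilnorKMod.consHom ℓ a 0)
  | n + 2 => exact LinearMap.congr_fun (cons_cons_of_add_eq_one n h) (v n)

open Classical in
/-- The action of the Milnor ring on the product of all mod-`ℓ` Milnor K-groups. -/
def MilnorKMod.action (ℓ : ℕ) (K : Type*) [Field K] :
    MilnorRing ℓ K →+* AddMonoid.End (∀ n, MilnorKMod.Degree ℓ K n) :=
  MilnorRing.lift (fun a => if h : a = 0 then 0 else MilnorKMod.shift ℓ (Units.mk0 a h))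
    (dif_pos rfl)
    (fun a b ha hb => by
      simp only [dif_neg ha, dif_neg hb, dif_neg (mul_ne_zero ha hb), Units.mk0_mul,
        MilnorKMod.shift_mul])
    (fun a b ha hb hab => by
      simp only [dif_neg ha, dif_neg hb, dif_neg hab]
      have hdiv : ∀ c (hc : c ≠ 0), MilnorKMod.shift ℓ (Units.mk0 c hc) -
          MilnorKMod.shift ℓ (Units.mk0 (a + b) hab) =
          MilnorKMod.shift ℓ (Units.mk0 c hc / Units.mk0 (a + b) hab) := fun c hc => by
        rw [sub_eq_iff_eq_add, ← MilnorKMod.shift_mul, div_mul_cancel]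
      rw [hdiv a ha, hdiv b hb]
      refine MilnorKMod.shift_mul_shift_of_add_eq_one ?_
      rw [Units.val_div_eq_div_val, Units.val_div_eq_div_val, Units.val_mk0, Units.val_mk0,
        Units.val_mk0, ← add_div, div_self hab])
    (AddMonoidHom.ext fun v => funext fun n =>
      (congrFun (AddMonoid.End.natCast_apply ℓ v) n).trans
        (MilnorKMod.natCast_nsmul (n := n) (v n)))

theorem MilnorKMod.action_sym (a : Kˣ) :
    MilnorKMod.action ℓ K (MilnorRing.sym ℓ (a : K)) = MilnorKMod.shift ℓ a := by
  refine (MilnorRing.lift_sym _ _ _ _ _).trans ?_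
  rw [dif_neg a.ne_zero, Units.mk0_val]

theorem MilnorKMod.action_prod_sym (s : ℕ) (b : ℕ → Kˣ) :
    MilnorKMod.action ℓ K ((List.range s).map fun i => MilnorRing.sym ℓ (b i : K)).prod
      (Pi.single (M := MilnorKMod.Degree ℓ K) 0 (milnorSymbol ℓ Fin.elim0 : MilnorKMod ℓ 0 K)) s = milnorSymbol ℓ fun i : Fin s => b i := by
  induction s generalizing b with
  | zero =>
    rw [List.range_zero, List.map_nil, List.prod_nil, map_one, AddMonoid.End.one_apply]
    refine (Pi.single_eq_same (M := MilnorKMod.Degree ℓ K) 0 _).trans ?_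
    congr 1
    exact Subsingleton.elim _ _
  | succ s ih =>
    rw [List.range_succ_eq_map, List.map_cons, List.prod_cons, map_mul, action_sym, List.map_map]
    change MilnorKMod.cons ℓ s (b 0) (_ : MilnorKMod ℓ s K) = _
    refine (congrArg _ (ih fun i => b (i + 1))).trans ?_
    rw [cons_milnorSymbol]
    congr 1
    funext i
    refine Fin.cases rfl (fun i => rfl) i

end MilnorKMod

theorem statement_1 (ℓ : ℕ) (hℓ : ℓ.Prime) (k K : Type*) [Field k] [Field K] [Algebra k K]
    [IsAlgClosed k] (hchar : ringChar k ≠ ℓ) (hK : IsFunctionField k K)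
    (d : ℕ) (hd : HasTrdeg k K d) :
    ∀ s : ℕ, d < s → ∀ x : MilnorKMod ℓ s K, x = 0 := by
  intro s hs x
  obtain ⟨t, ht⟩ := hd
  have hid : (LinearMap.id : MilnorKMod ℓ s K →ₗ[ℤ] MilnorKMod ℓ s K) = 0 := by
    refine MilnorKMod.hom_ext fun v => ?_
    let b : ℕ → Kˣ := fun i => if h : i < s then v ⟨i, h⟩ else 1
    have hb : v = fun i : Fin s => b i := funext fun i => by simp [b]
    rw [LinearMap.id_apply, LinearMap.zero_apply, hb, ← MilnorKMod.action_prod_sym,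
      MilnorRing.prod_sym_eq_zero hℓ.ne_zero (fun i => (b i : K)) s
        (MilnorRing.not_algebraicIndepOn_of_lt ht hs _), map_zero]
    rfl
  exact LinearMap.congr_fun hid x

end
end
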